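/- arXiv:1507.03551 — 2 statements merged into one kernel-verified Lean document; each statement's English description precedes it below -/
import Mathlib

section
/- Let ℓ:[0,∞)→[0,∞) be continuous, increasing, slowly varying at infinity, with ∫_0^{1/s} dt/(t ℓ(1/t)) < ∞, and set θ(s) = 1/∫_0^{1/s} dt/(t ℓ(1/t)). Let G be a finitely generated nilpotent group, not virtually torsion, equipped with a generating k-tuple (s₁,…,s_k), and let μ(g) = k^{-1} Σ_{i=1}^k Σ_{n∈ℤ} c·1_{s_i^n}(g)/((1+|n|)ℓ(1+|n|²)) (c a normalizing constant). If κ = θ∘exp is slowly varying at infinity and satisfies s κ^{-1}(s) ≃ κ^{-1}(s), then μ^{(n)}(e) ≃ exp(−n/κ(n)). -/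
open MeasureTheory Filter Topology Set
open scoped Classical BigOperators

noncomputable section

/-- Word length of `g` with respect to a set `S` of generators. -/
def wordLen {G : Type*} [Group G] (S : Set G) (g : G) : ℕ :=
  sInf {n | ∃ w : List G, (∀ x ∈ w, x ∈ S) ∧ w.length = n ∧ w.prod = g}

/-- The symmetric set associated with a generating tuple. -/
def symSet {G : Type*} [Group G] {k : ℕ} (s : Fin k → G) : Set G :=
  {x | ∃ i, x = s i ∨ x = (s i)⁻¹}

/-- Volume function: number of elements of word length at most `n`. -/
def vol {G : Type*} [Group G] (S : Set G) (n : ℕ) : ℕ :=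
  Set.ncard {g : G | wordLen S g ≤ n}

/-- `S` is a finite symmetric generating set. -/
def IsSymmGen {G : Type*} [Group G] (S : Set G) : Prop :=
  S.Finite ∧ (∀ x ∈ S, x⁻¹ ∈ S) ∧ Subgroup.closure S = ⊤

/-- Polynomial volume growth of degree `D`. -/
def PolyGrowth {G : Type*} [Group G] (S : Set G) (D : ℕ) : Prop :=
  ∃ c C : ℝ, 0 < c ∧ 0 < C ∧ ∀ n : ℕ, 1 ≤ n →
    c * (n : ℝ) ^ D ≤ (vol S n : ℝ) ∧ (vol S n : ℝ) ≤ C * (n : ℝ) ^ D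

/-- A symmetric probability measure on `G`, viewed as a density. -/
def IsSymmProb {G : Type*} [Group G] (μ : G → ℝ) : Prop :=
  (∀ g, 0 ≤ μ g) ∧ Summable μ ∧ (∑' g, μ g) = 1 ∧ (∀ g, μ g⁻¹ = μ g)

/-- Convolution of two densities on `G`. -/
def conv {G : Type*} [Group G] (μ ν : G → ℝ) : G → ℝ :=
  fun g => ∑' h, μ h * ν (h⁻¹ * g)

/-- Convolution powers `μ^{(n)}`. -/
def convPow {G : Type*} [Group G] (μ : G → ℝ) : ℕ → G → ℝ
  | 0 => fun g => if g = 1 then 1 else 0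
  | n + 1 => conv μ (convPow μ n)

/-- Mass a density gives to a set. -/
def massOf {G : Type*} (μ : G → ℝ) (A : Set G) : ℝ := ∑' g : A, μ (g : G)

/-- The weak `ρ`-moment of `μ` is bounded by `M`:
`sup_{s>0} s·μ({g : ρ(|g|) > s}) ≤ M`. -/
def WeakMomentLe {G : Type*} [Group G] (S : Set G) (ρ : ℝ → ℝ) (μ : G → ℝ) (M : ℝ) : Prop :=
  ∀ s : ℝ, 0 < s → s * massOf μ {g | ρ ((wordLen S g : ℝ)) > s} ≤ M

/-- `Φ̃_{G,ρ}(n)`: fastest decay of `φ^{(2n)}(e)` under the weak `ρ`-moment condition. -/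
def PhiTilde {G : Type*} [Group G] (S : Set G) (ρ : ℝ → ℝ) (n : ℕ) : ℝ :=
  sInf {x | ∃ μ : G → ℝ, IsSymmProb μ ∧ WeakMomentLe S ρ μ 2 ∧ x = convPow μ (2 * n) 1}

/-- Slow variation at infinity. -/
def SlowlyVarying (l : ℝ → ℝ) : Prop :=
  ∀ lam : ℝ, 0 < lam → Tendsto (fun x => l (lam * x) / l x) atTop (nhds 1)

/-- `ls` is a de Bruijn conjugate of the slowly varying function `l`. -/
def IsDeBruijnConjugate (l ls : ℝ → ℝ) : Prop :=
  SlowlyVarying ls ∧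
  Tendsto (fun x => l x * ls (x * l x)) atTop (nhds 1) ∧
  Tendsto (fun x => ls x * l (x * ls x)) atTop (nhds 1)

/-- Iterated logarithms: `log_{[0]} x = x`, `log_{[j]} x = log(1 + log_{[j-1]} x)`. -/
def logIter : ℕ → ℝ → ℝ
  | 0, x => x
  | n + 1, x => Real.log (1 + logIter n x)

/-- Base 2 iterated logarithms: `log_{2,1}(s) = log₂(1+s)`, `log_{2,j} = log_{2,1} ∘ log_{2,j-1}`. -/
def log2Iter : ℕ → ℝ → ℝ
  | 0, x => x
  | n + 1, x => Real.logb 2 (1 + log2Iter n x)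

/-- `θ(s) = 1/∫_0^{1/s} dt/(t ℓ(1/t))`. -/
def thetaOf (l : ℝ → ℝ) (s : ℝ) : ℝ :=
  1 / ∫ t in Set.Ioc (0:ℝ) (1/s), 1 / (t * l (1/t))

/-- Dirichlet form `E_μ(f,f) = (1/2) Σ_{x,y} |f(xy)-f(x)|² μ(y)`. -/
def dirichlet {G : Type*} [Group G] (μ : G → ℝ) (f : G → ℝ) : ℝ :=
  (1/2) * ∑' p : G × G, |f (p.1 * p.2) - f p.1| ^ 2 * μ p.2

/-- `f ∈ ℓ²(G)` (counting measure). -/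
def MemL2 {G : Type*} (f : G → ℝ) : Prop := Summable (fun x => (f x) ^ 2)

/-- Bernstein representation `ψ(s) = a + bs + ∫ (1-e^{-st}) dν(t)`,
with `ν` supported in `(0,∞)` and `∫ t/(1+t) dν < ∞`. -/
def IsBernsteinRep (ψ : ℝ → ℝ) (a b : ℝ) (ν : Measure ℝ) : Prop :=
  0 ≤ a ∧ 0 ≤ b ∧ ν (Set.Iic 0) = 0 ∧
  Integrable (fun t => t / (1 + t)) ν ∧
  ∀ s : ℝ, 0 < s → ψ s = a + b * s + ∫ t, (1 - Real.exp (-(s * t))) ∂ν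

/-- Bernstein function (via the classical representation). -/
def IsBernstein (ψ : ℝ → ℝ) : Prop := ∃ a b ν, IsBernsteinRep ψ a b ν

/-- Complete Bernstein function: `ψ(s) = s² ∫_0^∞ e^{-ts} g(t) dt` with `g` Bernstein. -/
def IsCompleteBernstein (ψ : ℝ → ℝ) : Prop :=
  ∃ g : ℝ → ℝ, IsBernstein g ∧
    ∀ s : ℝ, 0 < s → ψ s = s ^ 2 * ∫ t in Set.Ioi (0:ℝ), Real.exp (-(t * s)) * g t

/-- Subordination coefficients `c(ψ,n)` computed from representation data `(b,ν)`:
`c(ψ,1) = b + ∫ t e^{-t} dν`, `c(ψ,n) = (1/n!) ∫ tⁿ e^{-t} dν` for `n > 1`. -/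
def cPsi (b : ℝ) (ν : Measure ℝ) (n : ℕ) : ℝ :=
  if n = 0 then 0
  else (if n = 1 then b else 0) + (1 / (n.factorial : ℝ)) * ∫ t, t ^ n * Real.exp (-t) ∂ν

/-- Subordinated measure `Σ_{n} c(n) φ^{(n)}`. -/
def subord {G : Type*} [Group G] (φ : G → ℝ) (c : ℕ → ℝ) : G → ℝ :=
  fun x => ∑' n : ℕ, c n * convPow φ n x

/-- Tail `H_φ(r) = Σ_{|n|>r} φ(n)` of a measure on `ℤ`. -/
def Hphi (φ : ℤ → ℝ) (r : ℝ) : ℝ := ∑' n : ℤ, if r < (|n| : ℝ) then φ n else 0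

/-- Truncated second moment `G_φ(r) = Σ_{|n|≤r} n² φ(n)`. -/
def Gphi (φ : ℤ → ℝ) (r : ℝ) : ℝ := ∑' n : ℤ, if (|n| : ℝ) ≤ r then (n : ℝ) ^ 2 * φ n else 0

/-- `E_{s,φ}(f,f) = (1/2) Σ_{x∈G} Σ_{n∈ℤ} |f(xsⁿ)-f(x)|² φ(n)`. -/
def EsPhi {G : Type*} [Group G] (s : G) (φ : ℤ → ℝ) (f : G → ℝ) : ℝ :=
  (1/2) * ∑' p : G × ℤ, |f (p.1 * s ^ p.2) - f p.1| ^ 2 * φ p.2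

/-- Symmetric probability measure on `ℤ`. -/
def IsSymmProbZ (φ : ℤ → ℝ) : Prop :=
  (∀ n, 0 ≤ φ n) ∧ Summable φ ∧ (∑' n, φ n) = 1 ∧ (∀ n, φ (-n) = φ n)

/-- Measure supported on powers of generators:
`μ(g) = k⁻¹ Σ_i Σ_{n∈ℤ} w(n) 1_{s_iⁿ}(g)`. -/
def genMeasure {G : Type*} [Group G] {k : ℕ} (s : Fin k → G) (w : ℤ → ℝ) : G → ℝ :=
  fun g => (k : ℝ)⁻¹ * ∑ i : Fin k, ∑' n : ℤ, if g = s i ^ n then w n else 0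

/-- Coefficients in `1-(1-x)^α = Σ_{n≥1} c_α(n) xⁿ`. -/
def cAlpha (a : ℝ) (n : ℕ) : ℝ :=
  if n = 0 then 0
  else (-1) ^ (n + 1) * (∏ j ∈ Finset.range n, (a - j)) / (n.factorial : ℝ)
section Growth
open scoped Pointwise commutatorElement

def gT {G : Type*} [Group G] (S : Set G) : Set G := insert 1 (S ∪ S⁻¹)

lemma gT_one {G : Type*} [Group G] (S : Set G) : (1 : G) ∈ gT S := Set.mem_insert _ _

lemma gT_mono {G : Type*} [Group G] {S S' : Set G} (h : S ⊆ S') : gT S ⊆ gT S' := by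
  unfold gT
  exact Set.insert_subset_insert (Set.union_subset_union h (Set.inv_subset_inv.2 h))

lemma gT_sub {G : Type*} [Group G] (S : Set G) : S ⊆ gT S := by
  intro x hx; exact Or.inr (Or.inl hx)

lemma gT_inv {G : Type*} [Group G] (S : Set G) : (gT S)⁻¹ = gT S := by
  ext x; simp [gT, or_comm]

lemma gT_pow_mono {G : Type*} [Group G] (S : Set G) {m n : ℕ} (h : m ≤ n) :
    gT S ^ m ⊆ gT S ^ n := Set.pow_subset_pow_right (gT_one S) h

lemma gT_pow_inv {G : Type*} [Group G] (S : Set G) (n : ℕ) {x : G} (h : x ∈ gT S ^ n) :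
    x⁻¹ ∈ gT S ^ n := by
  rw [← Set.mem_inv, ← inv_pow, gT_inv]; exact h

lemma gT_mul {G : Type*} [Group G] (S : Set G) {m n : ℕ} {x y : G} (h : x ∈ gT S ^ m)
    (h' : y ∈ gT S ^ n) : x * y ∈ gT S ^ (m + n) := by
  rw [pow_add]; exact Set.mul_mem_mul h h'

lemma gT_closure {G : Type*} [Group G] (S : Set G) {x : G} (h : x ∈ Subgroup.closure S) :
    ∃ n, x ∈ gT S ^ n := by
  induction h using Subgroup.closure_induction with
  | mem x hx => exact ⟨1, by simpa using gT_sub S hx⟩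
  | one => exact ⟨0, by simp⟩
  | mul x y _ _ h1 h2 =>
    obtain ⟨n, h1⟩ := h1
    obtain ⟨m, h2⟩ := h2
    exact ⟨n + m, gT_mul S h1 h2⟩
  | inv x _ h1 =>
    obtain ⟨n, h1⟩ := h1
    exact ⟨n, gT_pow_inv S n h1⟩

/-- central sequences -/
def CSeq {G : Type*} [Group G] : List G → Prop
  | [] => True
  | y :: u => (∀ g : G, ⁅g, y⁆ ∈ Subgroup.closure {x | x ∈ u}) ∧ CSeq u

lemma CSeq_append {G : Type*} [Group G] (A B : List G) (hB : CSeq B)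
    (hA : ∀ y ∈ A, ∀ g : G, ⁅g, y⁆ ∈ Subgroup.closure {x | x ∈ B}) : CSeq (A ++ B) := by
  induction A with
  | nil => exact hB
  | cons y u ih =>
    refine ⟨fun g => ?_, ih fun z hz => hA z (List.mem_cons_of_mem _ hz)⟩
    refine Subgroup.closure_mono ?_ (hA y List.mem_cons_self g)
    intro x hx
    exact List.mem_append_right _ hx

lemma conj_poly_nat {G : Type*} [Group G] (L : List G) (hL : CSeq L) (g : G) :
    ∃ C D : ℕ, ∀ b : ℕ, ∀ y ∈ gT {x | x ∈ L},
      g ^ b * y * (g ^ b)⁻¹ ∈ gT {x | x ∈ L} ^ (C * (b + 1) ^ D) := by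
  induction L with
  | nil =>
    refine ⟨0, 0, fun b y hy => ?_⟩
    have : y = 1 := by simpa [gT] using hy
    simp [this]
  | cons y u ih =>
    obtain ⟨hy, hu⟩ := hL
    obtain ⟨C, D, hCD⟩ := ih hu
    obtain ⟨q, hq⟩ := gT_closure _ (hy g)
    have hsub : {x | x ∈ u} ⊆ {x | x ∈ y :: u} := fun x hx => List.mem_cons_of_mem _ hx
    have hpw : ∀ (b m : ℕ) (w : G), w ∈ gT {x | x ∈ u} ^ m →
        g ^ b * w * (g ^ b)⁻¹ ∈ gT {x | x ∈ u} ^ ((C * (b + 1) ^ D) * m) := by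
      intro b m
      induction m with
      | zero => intro w hw; simp at hw; simp [hw]
      | succ m ihm =>
        intro w hw
        rw [pow_succ] at hw
        obtain ⟨w1, h1, w2, h2, rfl⟩ := Set.mem_mul.1 hw
        have e : g ^ b * (w1 * w2) * (g ^ b)⁻¹
          = (g ^ b * w1 * (g ^ b)⁻¹) * (g ^ b * w2 * (g ^ b)⁻¹) := by group
        rw [e, mul_add, mul_one]
        exact gT_mul _ (ihm _ h1) (hCD b w2 h2)
    have key : ∀ b B : ℕ, b ≤ B →
        g ^ b * y * (g ^ b)⁻¹ ∈ gT {x | x ∈ y :: u} ^ (1 + b * ((C * (B + 1) ^ D) * q)) := by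
      intro b B
      induction b with
      | zero =>
        intro _
        simp only [pow_zero, one_mul, inv_one, mul_one, zero_mul, add_zero, pow_one]
        exact gT_sub _ List.mem_cons_self
      | succ b ihb =>
        intro hb
        have e : g ^ (b+1) * y * (g ^ (b+1))⁻¹
          = (g ^ b * ⁅g, y⁆ * (g ^ b)⁻¹) * (g ^ b * y * (g ^ b)⁻¹) := by
          rw [commutatorElement_def, pow_succ]; group
        rw [e]
        have h1 : g ^ b * ⁅g, y⁆ * (g ^ b)⁻¹ ∈ gT {x | x ∈ y :: u} ^ ((C * (B + 1) ^ D) * q) := by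
          refine Set.pow_subset_pow_left (gT_mono hsub) (gT_pow_mono _ ?_ (hpw b q _ hq))
          gcongr; omega
        have := gT_mul _ h1 (ihb (by omega))
        convert this using 2
        ring
    have le1 : ∀ b : ℕ, C * (b + 1) ^ D ≤ (1 + C + C * q) * (b + 1) ^ (D + 1) := by
      intro b
      apply Nat.mul_le_mul
      · nlinarith [Nat.zero_le (C * q)]
      · exact Nat.pow_le_pow_right (by omega) (by omega)
    have le2 : ∀ b : ℕ, 1 + b * ((C * (b + 1) ^ D) * q) ≤ (1 + C + C * q) * (b + 1) ^ (D + 1) := by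
      intro b
      have : 1 ≤ (b + 1) ^ (D + 1) := Nat.one_le_pow _ _ (by omega)
      have h2 : b * ((C * (b + 1) ^ D) * q) ≤ (C * q) * (b + 1) ^ (D + 1) := by
        have : (C * q) * (b + 1) ^ (D + 1) = (b + 1) * ((C * (b + 1) ^ D) * q) := by ring
        rw [this]; gcongr; omega
      nlinarith [Nat.zero_le (C * (b + 1) ^ (D + 1))]
    refine ⟨1 + C + C * q, D + 1, fun b z hz => ?_⟩
    have hz' : z = y ∨ z⁻¹ = y ∨ z ∈ gT {x | x ∈ u} := by
      rcases hz with h | h | h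
      · exact Or.inr (Or.inr (h ▸ gT_one _))
      · rcases List.mem_cons.1 h with h | h
        · exact Or.inl h
        · exact Or.inr (Or.inr (gT_sub _ h))
      · rcases List.mem_cons.1 (Set.mem_inv.1 h) with h | h
        · exact Or.inr (Or.inl h)
        · exact Or.inr (Or.inr (Or.inr (Or.inr (Set.mem_inv.2 h))))
    rcases hz' with rfl | h | h
    · exact gT_pow_mono _ (le2 b) (key b b le_rfl)
    · have := gT_pow_inv _ _ (gT_pow_mono _ (le2 b) (key b b le_rfl))
      rw [← h] at this ⊢
      convert this using 1
      group
    · exact Set.pow_subset_pow_left (gT_mono hsub) (gT_pow_mono _ (le1 b) (hCD b z h))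

lemma conj_poly {G : Type*} [Group G] (L : List G) (hL : CSeq L) (g : G) :
    ∃ C D : ℕ, ∀ (b : ℤ) (B : ℕ), |b| ≤ B → ∀ y ∈ gT {x | x ∈ L},
      g ^ b * y * (g ^ b)⁻¹ ∈ gT {x | x ∈ L} ^ (C * (B + 1) ^ D) := by
  obtain ⟨C, D, h⟩ := conj_poly_nat L hL g
  obtain ⟨C', D', h'⟩ := conj_poly_nat L hL g⁻¹
  refine ⟨C + C', D + D', fun b B hb y hy => ?_⟩
  have hB : 1 ≤ B + 1 := by omega
  rcases Int.eq_nat_or_neg b with ⟨n, rfl | rfl⟩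
  · have hn : n ≤ B := by
      have : |(n:ℤ)| = n := abs_of_nonneg (by positivity)
      omega
    rw [zpow_natCast]
    refine gT_pow_mono _ ?_ (h n y hy)
    calc C * (n + 1) ^ D ≤ (C + C') * (B + 1) ^ D := by gcongr; omega
      _ ≤ _ := by gcongr <;> omega
  · have hn : n ≤ B := by
      have : |-(n:ℤ)| = n := by rw [abs_neg]; exact abs_of_nonneg (by positivity)
      omega
    rw [zpow_neg, zpow_natCast, ← inv_pow]
    refine gT_pow_mono _ ?_ (h' n y hy)
    calc C' * (n + 1) ^ D' ≤ (C + C') * (B + 1) ^ D' := by gcongr; omega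
      _ ≤ _ := by gcongr <;> omega

lemma growth_CSeq {G : Type*} [Group G] (L : List G) (hL : CSeq L) :
    ∃ C D : ℕ, ∀ r : ℕ, ∃ F : Finset G, gT {x | x ∈ L} ^ r ⊆ (F : Set G) ∧
      F.card ≤ C * (r + 1) ^ D := by
  induction L with
  | nil =>
    refine ⟨1, 0, fun r => ⟨{1}, ?_, by simp⟩⟩
    have : gT {x : G | x ∈ ([] : List G)} = 1 := by ext x; simp [gT]
    rw [this, one_pow]; simp
  | cons y u ih =>
    obtain ⟨hy, hu⟩ := hL
    obtain ⟨Cu, Du, hF⟩ := ih hu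
    obtain ⟨C, D, hC⟩ := conj_poly u hu y
    refine ⟨2 * Cu * (C + 1) ^ Du, 1 + (D + 1) * Du, fun R => ?_⟩
    have key : ∀ r : ℕ, r ≤ R → ∀ x ∈ gT {x | x ∈ y :: u} ^ r, ∃ a : ℤ, |a| ≤ r ∧
        ∃ v ∈ gT {x | x ∈ u} ^ (r * (C * (R + 1) ^ D)), x = y ^ a * v := by
      intro r
      induction r with
      | zero => intro _ x hx; exact ⟨0, by simp, 1, by simp, by simpa using hx⟩
      | succ r ihr =>
        intro hr x hx
        rw [pow_succ'] at hx
        obtain ⟨t, ht, x', hx', rfl⟩ := Set.mem_mul.1 hx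
        obtain ⟨a, ha, v, hv, rfl⟩ := ihr (by omega) x' hx'
        have hle : r * (C * (R + 1) ^ D) ≤ (r + 1) * (C * (R + 1) ^ D) := by gcongr; omega
        have hz' : t = y ∨ t⁻¹ = y ∨ t ∈ gT {x | x ∈ u} := by
          rcases ht with h | h | h
          · exact Or.inr (Or.inr (h ▸ gT_one _))
          · rcases List.mem_cons.1 h with h | h
            · exact Or.inl h
            · exact Or.inr (Or.inr (gT_sub _ h))
          · rcases List.mem_cons.1 (Set.mem_inv.1 h) with h | h
            · exact Or.inr (Or.inl h)
            · exact Or.inr (Or.inr (Or.inr (Or.inr (Set.mem_inv.2 h))))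
        rcases hz' with rfl | h | h
        · refine ⟨1 + a, ?_, v, gT_pow_mono _ hle hv, ?_⟩
          · have := abs_add_le 1 a
            push_cast; simp at this; omega
          · rw [zpow_add, zpow_one, mul_assoc]
        · refine ⟨-1 + a, ?_, v, gT_pow_mono _ hle hv, ?_⟩
          · have := abs_add_le (-1) a
            push_cast; simp at this; omega
          · rw [zpow_add, zpow_neg, zpow_one, mul_assoc, ← h, inv_inv]
        · refine ⟨a, by push_cast; omega, (y ^ (-a) * t * (y ^ (-a))⁻¹) * v, ?_, by group⟩
          have e : (r + 1) * (C * (R + 1) ^ D) = (C * (R + 1) ^ D) + r * (C * (R + 1) ^ D) := by ring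
          rw [e]
          refine gT_mul _ (hC (-a) R ?_ t h) hv
          rw [abs_neg]; omega
    obtain ⟨F, hF1, hF2⟩ := hF (R * (C * (R + 1) ^ D))
    refine ⟨Finset.image (fun p : ℤ × G => y ^ p.1 * p.2) (Finset.Icc (-(R:ℤ)) R ×ˢ F), ?_, ?_⟩
    · intro x hx
      obtain ⟨a, ha, v, hv, rfl⟩ := key R le_rfl x hx
      simp only [Finset.coe_image, Set.mem_image, Finset.mem_coe, Finset.mem_product, Finset.mem_Icc]
      exact ⟨(a, v), ⟨abs_le.1 ha, hF1 hv⟩, rfl⟩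
    · refine Finset.card_image_le.trans ?_
      rw [Finset.card_product]
      have h1 : (Finset.Icc (-(R:ℤ)) R).card ≤ 2 * (R + 1) := by
        rw [Int.card_Icc]; omega
      have h2 : R * (C * (R + 1) ^ D) + 1 ≤ (C + 1) * (R + 1) ^ (D + 1) := by
        have : 1 ≤ (R + 1) ^ (D + 1) := Nat.one_le_pow _ _ (by omega)
        have h2 : R * (C * (R + 1) ^ D) ≤ C * (R + 1) ^ (D + 1) := by
          have : C * (R + 1) ^ (D + 1) = (R + 1) * (C * (R + 1) ^ D) := by ring
          rw [this]; gcongr; omega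
        nlinarith
      calc (Finset.Icc (-(R:ℤ)) R).card * F.card
          ≤ (2 * (R + 1)) * (Cu * ((C + 1) * (R + 1) ^ (D + 1)) ^ Du) :=
            Nat.mul_le_mul h1 (hF2.trans (by gcongr))
        _ = _ := by rw [mul_pow, ← pow_mul, pow_add]; ring

/-- iterated commutators -/
def itC {G : Type*} [Group G] (S : List G) : ℕ → List G
  | 0 => S
  | w + 1 => (itC S w ×ˢ S).map fun p => ⁅p.1, p.2⁆

lemma itC_lcs {G : Type*} [Group G] (S : List G) (w : ℕ) :
    ∀ x ∈ itC S w, x ∈ (⊤ : Subgroup G).lowerCentralSeries w := by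
  induction w with
  | zero => intro x _; simp
  | succ w ih =>
    intro x hx
    simp only [itC, List.mem_map, Prod.exists] at hx
    obtain ⟨a, b, hab, rfl⟩ := hx
    rw [List.mem_product] at hab
    rw [Subgroup.lowerCentralSeries_succ]
    exact Subgroup.commutator_mem_commutator (ih a hab.1) (Subgroup.mem_top b)

lemma exists_CSeq {G : Type*} [Group G] [Group.IsNilpotent G] (S : List G)
    (hS : Subgroup.closure {x | x ∈ S} = ⊤) (hinv : ∀ x ∈ S, x⁻¹ ∈ S) :
    ∃ L : List G, CSeq L ∧ Subgroup.closure {x | x ∈ L} = ⊤ := by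
  obtain ⟨c, hc⟩ := Subgroup.nilpotent_iff_lowerCentralSeries.1 (inferInstance : Group.IsNilpotent G)
  set N : ℕ → Subgroup G := fun w => Subgroup.closure {x | ∃ v, w ≤ v ∧ x ∈ itC S v} with hN
  have hNmem : ∀ w v, w ≤ v → ∀ x ∈ itC S v, x ∈ N w := fun w v h x hx =>
    Subgroup.subset_closure ⟨v, h, hx⟩
  have hcomm : ∀ v, ∀ x ∈ itC S v, ∀ t ∈ S, ⁅x, t⁆ ∈ itC S (v + 1) := by
    intro v x hx t ht
    simp only [itC, List.mem_map, Prod.exists]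
    exact ⟨x, t, List.mem_product.2 ⟨hx, ht⟩, rfl⟩
  have hconj : ∀ w, ∀ t ∈ S, ∀ x ∈ N w, t * x * t⁻¹ ∈ N w := by
    intro w t ht x hx
    induction hx using Subgroup.closure_induction with
    | mem x hx =>
      obtain ⟨v, hv, hx⟩ := hx
      have h1 := hNmem w (v+1) (by omega) _ (hcomm v x hx t ht)
      have h2 := hNmem w v hv x hx
      have : t * x * t⁻¹ = (⁅x, t⁆)⁻¹ * x := by rw [commutatorElement_def]; group
      rw [this]
      exact (N w).mul_mem ((N w).inv_mem h1) h2
    | one => simp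
    | mul x y _ _ h1 h2 =>
      have : t * (x * y) * t⁻¹ = (t * x * t⁻¹) * (t * y * t⁻¹) := by group
      rw [this]; exact (N w).mul_mem h1 h2
    | inv x _ h1 =>
      have : t * x⁻¹ * t⁻¹ = (t * x * t⁻¹)⁻¹ := by group
      rw [this]; exact (N w).inv_mem h1
  have hnormal : ∀ w, (N w).Normal := by
    intro w
    refine ⟨fun x hx g => ?_⟩
    have hg : g ∈ Subgroup.closure {x | x ∈ S} := by rw [hS]; trivial
    induction hg using Subgroup.closure_induction generalizing x with
    | mem t ht => exact hconj w t ht x hx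
    | one => simpa using hx
    | mul a b _ _ h1 h2 =>
      have : a * b * x * (a * b)⁻¹ = a * (b * x * b⁻¹) * a⁻¹ := by group
      rw [this]; exact h1 _ (h2 _ hx)
    | inv a ha h1 =>
      -- induct for inverse via the inverse closure
      have ha' : a⁻¹ ∈ Subgroup.closure {x | x ∈ S} := inv_mem ha
      clear h1
      have : ∀ y ∈ Subgroup.closure {x | x ∈ S}, (∀ x ∈ N w, y * x * y⁻¹ ∈ N w) ∧
          (∀ x ∈ N w, y⁻¹ * x * y⁻¹⁻¹ ∈ N w) := by
        intro y hy
        induction hy using Subgroup.closure_induction with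
        | mem t ht => exact ⟨hconj w t ht, hconj w t⁻¹ (hinv t ht)⟩
        | one => simp
        | mul a b _ _ h1 h2 =>
          refine ⟨fun x hx => ?_, fun x hx => ?_⟩
          · have : a * b * x * (a * b)⁻¹ = a * (b * x * b⁻¹) * a⁻¹ := by group
            rw [this]; exact h1.1 _ (h2.1 _ hx)
          · have : (a * b)⁻¹ * x * (a * b)⁻¹⁻¹ = b⁻¹ * (a⁻¹ * x * a⁻¹⁻¹) * b⁻¹⁻¹ := by group
            rw [this]; exact h2.2 _ (h1.2 _ hx)
        | inv a _ h1 => exact ⟨h1.2, by simpa using h1.1⟩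
      exact (this _ ha').1 x hx
  have hcent : ∀ v, ∀ x ∈ itC S v, ∀ g : G, ⁅g, x⁆ ∈ N (v + 1) := by
    intro v x hx g
    haveI := hnormal (v + 1)
    have hg : g ∈ Subgroup.closure {x | x ∈ S} := by rw [hS]; trivial
    have hq : ∀ a b : G, ⁅a, b⁆ ∈ N (v+1) ↔ Commute (a : G ⧸ N (v+1)) (b : G ⧸ N (v+1)) := by
      intro a b
      rw [← QuotientGroup.eq_one_iff, commutatorElement_def]
      rw [← commutatorElement_eq_one_iff_commute, commutatorElement_def]
      rfl
    rw [hq]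
    induction hg using Subgroup.closure_induction with
    | mem t ht =>
      exact ((hq _ _).1 (hNmem _ _ le_rfl _ (hcomm v x hx t ht))).symm
    | one => exact Commute.one_left _
    | mul a b _ _ h1 h2 => exact Commute.mul_left h1 h2
    | inv a _ h1 => exact Commute.inv_left h1
  have main : ∀ d w, w + d = c → ∃ L : List G, CSeq L ∧ Subgroup.closure {x | x ∈ L} = N w := by
    intro d
    induction d with
    | zero =>
      intro w hw
      refine ⟨[], trivial, ?_⟩
      have : N w = ⊥ := by
        rw [hN, Subgroup.closure_eq_bot_iff]
        rintro x ⟨v, hv, hx⟩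
        have := itC_lcs S v x hx
        have h2 := Subgroup.lowerCentralSeries_antitone (S := (⊤ : Subgroup G)) (show c ≤ v by omega) this
        rw [hc] at h2
        exact h2
      rw [this]; simp
    | succ d ih =>
      intro w hw
      obtain ⟨L, hL, hL2⟩ := ih (w + 1) (by omega)
      refine ⟨itC S w ++ L, CSeq_append _ _ hL ?_, ?_⟩
      · intro y hy g
        rw [hL2]; exact hcent w y hy g
      · apply le_antisymm
        · rw [Subgroup.closure_le]
          intro x hx
          rcases List.mem_append.1 hx with h | h
          · exact hNmem w w le_rfl x h
          · have : x ∈ N (w + 1) := by rw [← hL2]; exact Subgroup.subset_closure h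
            refine Subgroup.closure_mono ?_ this
            rintro z ⟨v, hv, hz⟩
            exact ⟨v, by omega, hz⟩
        · rw [hN, Subgroup.closure_le]
          rintro x ⟨v, hv, hx⟩
          rcases Nat.eq_or_lt_of_le hv with rfl | h
          · exact Subgroup.subset_closure (List.mem_append_left _ hx)
          · have : x ∈ Subgroup.closure {x | x ∈ L} := by rw [hL2]; exact hNmem _ v h x hx
            refine Subgroup.closure_mono ?_ this
            intro z hz
            exact List.mem_append_right _ hz
  obtain ⟨L, h1, h2⟩ := main c 0 (by omega)
  refine ⟨L, h1, ?_⟩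
  rw [h2, eq_top_iff, ← hS]
  exact Subgroup.closure_mono fun x hx => ⟨0, le_rfl, hx⟩

theorem growth_nilpotent {G : Type*} [Group G] [Group.IsNilpotent G] {k : ℕ}
    (s : Fin k → G) (hgen : Subgroup.closure (Set.range s) = ⊤) :
    ∃ C D : ℕ, ∀ r : ℕ, ∃ F : Finset G, gT (Set.range s) ^ r ⊆ (F : Set G) ∧
      F.card ≤ C * (r + 1) ^ D := by
  obtain ⟨L, hL, hL2⟩ := exists_CSeq (G := G) (List.ofFn s ++ List.ofFn fun i => (s i)⁻¹) (by
      rw [eq_top_iff, ← hgen]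
      apply Subgroup.closure_mono
      rintro _ ⟨i, rfl⟩
      exact List.mem_append_left _ (by simp)) (by
      intro x hx
      simp only [List.mem_append, List.mem_ofFn] at hx ⊢
      rcases hx with ⟨i, rfl⟩ | ⟨i, rfl⟩
      · exact Or.inr ⟨i, rfl⟩
      · exact Or.inl ⟨i, by simp⟩)
  obtain ⟨C, D, h⟩ := growth_CSeq L hL
  have hq : ∀ i, ∃ n, s i ∈ gT {x | x ∈ L} ^ n := fun i =>
    gT_closure _ (by rw [hL2]; trivial)
  choose q hq using hq
  set Q := ∑ i, q i with hQ
  have hsub : gT (Set.range s) ⊆ gT {x | x ∈ L} ^ Q := by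
    have h1 : ∀ i, s i ∈ gT {x | x ∈ L} ^ Q := fun i =>
      gT_pow_mono _ (Finset.single_le_sum (f := q) (fun _ _ => Nat.zero_le _) (Finset.mem_univ i)) (hq i)
    rintro x (h | ⟨i, rfl⟩ | h)
    · rw [h]; exact gT_pow_mono _ (Nat.zero_le _) (by simp)
    · exact h1 i
    · obtain ⟨i, hi⟩ := Set.mem_inv.1 h
      have := gT_pow_inv _ _ (h1 i)
      rwa [hi, inv_inv] at this
  refine ⟨C * (Q + 1) ^ D, D, fun r => ?_⟩
  obtain ⟨F, hF1, hF2⟩ := h (Q * r)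
  refine ⟨F, ?_, hF2.trans ?_⟩
  · refine Set.Subset.trans ?_ hF1
    rw [pow_mul]
    exact Set.pow_subset_pow_left hsub
  · rw [mul_assoc, ← mul_pow]
    gcongr
    nlinarith

end Growth

section ProbB
open scoped Pointwise

lemma hasSum_push {G ι : Type*} (f : ι → G) (w : ι → ℝ) (hw : Summable w) :
    HasSum (fun g => ∑' n, if g = f n then w n else 0) (∑' n, w n) := by
  have h1 : HasSum (w ∘ Equiv.sigmaFiberEquiv f) (∑' n, w n) :=
    (Equiv.sigmaFiberEquiv f).hasSum_iff.2 hw.hasSum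
  refine HasSum.sigma h1 fun g => ?_
  have h2 : Summable (fun n => if g = f n then w n else 0) := by
    have := hw.indicator {n | g = f n}
    refine this.congr fun n => ?_
    simp [Set.indicator_apply]
  have h3 := (hasSum_subtype_iff_indicator (f := w) (s := {n | f n = g})
      (a := ∑' n, if g = f n then w n else 0)).2 (by
    convert h2.hasSum using 1
    ext n
    simp [Set.indicator_apply, eq_comm])
  exact h3

lemma conv_hasSum {G : Type*} [Group G] (a b : G → ℝ) (ha : ∀ g, 0 ≤ a g) (hb : ∀ g, 0 ≤ b g)
    {A B : ℝ} (hA : HasSum a A) (hB : HasSum b B) : HasSum (conv a b) (A * B) := by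
  have h1 : HasSum (fun p : G × G => a p.1 * b p.2) (A * B) := by
    have := hA.summable.mul_of_nonneg hB.summable (fun g => ha g) (fun g => hb g)
    exact hA.mul hB this
  let e : G × G ≃ G × G :=
    { toFun := fun p => (p.2, p.2⁻¹ * p.1)
      invFun := fun p => (p.1 * p.2, p.1)
      left_inv := fun p => by simp
      right_inv := fun p => by simp }
  have h2 : HasSum ((fun p : G × G => a p.1 * b p.2) ∘ e) (A * B) := e.hasSum_iff.2 h1
  refine h2.prod_fiberwise fun g => ?_
  have : Summable fun h => ((fun p : G × G => a p.1 * b p.2) ∘ e) (g, h) :=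
    h2.summable.prod_factor g
  exact this.hasSum

lemma conv_nonneg {G : Type*} [Group G] (a b : G → ℝ) (ha : ∀ g, 0 ≤ a g) (hb : ∀ g, 0 ≤ b g)
    (g : G) : 0 ≤ conv a b g := tsum_nonneg fun _ => mul_nonneg (ha _) (hb _)

lemma convPow_nonneg {G : Type*} [Group G] (a : G → ℝ) (ha : ∀ g, 0 ≤ a g) (n : ℕ) (g : G) :
    0 ≤ convPow a n g := by
  induction n generalizing g with
  | zero => simp only [convPow]; split_ifs <;> norm_num
  | succ n ih => exact conv_nonneg _ _ ha ih g

lemma convPow_hasSum {G : Type*} [Group G] (a : G → ℝ) (ha : ∀ g, 0 ≤ a g) (h1 : HasSum a 1)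
    (n : ℕ) : HasSum (convPow a n) 1 := by
  induction n with
  | zero => exact hasSum_ite_eq 1 1
  | succ n ih =>
    have := conv_hasSum a _ ha (convPow_nonneg a ha n) h1 ih
    rwa [one_mul] at this

lemma convPow_le_one {G : Type*} [Group G] (a : G → ℝ) (ha : ∀ g, 0 ≤ a g) (h1 : HasSum a 1)
    (n : ℕ) (g : G) : convPow a n g ≤ 1 :=
  le_hasSum (convPow_hasSum a ha h1 n) g fun j _ => convPow_nonneg a ha n j

lemma summable_conv {G : Type*} [Group G] (a b : G → ℝ) (ha : ∀ g, 0 ≤ a g) (hb : ∀ g, 0 ≤ b g)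
    (hs : Summable a) (hb1 : ∀ g, b g ≤ 1) (g : G) :
    Summable fun h => a h * b (h⁻¹ * g) :=
  Summable.of_nonneg_of_le (fun _ => mul_nonneg (ha _) (hb _))
    (fun _ => mul_le_of_le_one_right (ha _) (hb1 _)) hs

lemma upper_gen {G : Type*} [Group G] (μ α β : G → ℝ) (hα : ∀ g, 0 ≤ α g) (hβ : ∀ g, 0 ≤ β g)
    (hμ : ∀ g, μ g = α g + β g) (h1 : HasSum μ 1) (h B : ℝ) (hh : 0 < h) (hh1 : h ≤ 1)
    (hβs : HasSum β h) (hB : ∀ g, β g ≤ B) (n : ℕ) (g : G) :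
    convPow μ n g ≤ (1 - h) ^ n + B / h := by
  have hμ0 : ∀ g, 0 ≤ μ g := fun g => by rw [hμ]; exact add_nonneg (hα g) (hβ g)
  have hαs : HasSum α (1 - h) := by
    have := h1.sub hβs
    have e : (fun g => μ g - β g) = α := by funext g; rw [hμ]; ring
    rwa [e] at this
  have hB0 : 0 ≤ B := (hβ 1).trans (hB 1)
  induction n generalizing g with
  | zero =>
    simp only [convPow, pow_zero]
    have : 0 ≤ B / h := by positivity
    split_ifs <;> linarith
  | succ n ih =>
    have P0 := convPow_nonneg μ hμ0 n
    have P1 := convPow_le_one μ hμ0 h1 n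
    have s1 := summable_conv α _ hα P0 hαs.summable P1 g
    have s2 := summable_conv β _ hβ P0 hβs.summable P1 g
    have e : convPow μ (n+1) g = (∑' x, α x * convPow μ n (x⁻¹ * g)) +
        ∑' x, β x * convPow μ n (x⁻¹ * g) := by
      rw [← s1.tsum_add s2]
      simp only [convPow, conv]
      refine tsum_congr fun x => ?_
      rw [hμ x]; ring
    have b1 : (∑' x, α x * convPow μ n (x⁻¹ * g)) ≤ (1 - h) * ((1 - h) ^ n + B / h) := by
      rw [← (hαs.mul_right ((1 - h) ^ n + B / h)).tsum_eq]
      refine s1.tsum_le_tsum (fun x => ?_) (hαs.mul_right _).summable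
      exact mul_le_mul_of_nonneg_left (ih _) (hα x)
    have b2 : (∑' x, β x * convPow μ n (x⁻¹ * g)) ≤ B := by
      have hs : HasSum (fun x : G => convPow μ n (x⁻¹ * g)) 1 := by
        have := convPow_hasSum μ hμ0 h1 n
        let e : G ≃ G := (Equiv.inv G).trans (Equiv.mulRight g)
        exact (e.hasSum_iff (f := convPow μ n)).2 this
      have h3 := hs.mul_left B
      rw [mul_one] at h3
      rw [← h3.tsum_eq]
      refine s2.tsum_le_tsum (fun x => ?_) h3.summable
      exact mul_le_mul_of_nonneg_right (hB x) (P0 _)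
    rw [e]
    have : (1 - h) * ((1 - h) ^ n + B / h) + B = (1 - h) ^ (n+1) + B / h := by
      field_simp; ring
    linarith

lemma lower_gen {G : Type*} [Group G] (μ : G → ℝ) (hμ : ∀ g, 0 ≤ μ g) (h1 : HasSum μ 1)
    (a : MonoidAlgebra ℝ G) (ha0 : ∀ g, 0 ≤ a.coeff g) (ha : ∀ g, a.coeff g ≤ μ g)
    (hsym : ∀ g, a.coeff g⁻¹ = a.coeff g) (n : ℕ) (F : Finset G) (V : Set G)
    (hV : (a.coeff.support : Set G) ⊆ V) (hF : V ^ n ⊆ (F : Set G)) :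
    (a.coeff.sum fun _ r => r) ^ (2 * n) ≤ F.card * convPow μ (2 * n) 1 := by
  have pos : ∀ n g, 0 ≤ (a ^ n).coeff g := by
    intro n
    induction n with
    | zero => intro g; rw [pow_zero, MonoidAlgebra.one_def, MonoidAlgebra.coeff_single, Finsupp.single_apply]; split_ifs <;> norm_num
    | succ n ih =>
      intro g
      rw [pow_succ', MonoidAlgebra.coeff_mul_apply_left]
      exact Finset.sum_nonneg fun h _ => mul_nonneg (ha0 _) (ih _)
  have le : ∀ n g, (a ^ n).coeff g ≤ convPow μ n g := by
    intro n
    induction n with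
    | zero =>
      intro g
      rw [pow_zero, MonoidAlgebra.one_def, MonoidAlgebra.coeff_single, Finsupp.single_apply]
      simp only [convPow, eq_comm, le_refl]
    | succ n ih =>
      intro g
      rw [pow_succ', MonoidAlgebra.coeff_mul_apply_left]
      have s1 := summable_conv μ _ hμ (convPow_nonneg μ hμ n) h1.summable (convPow_le_one μ hμ h1 n) g
      refine le_trans ?_ (s1.sum_le_tsum a.coeff.support fun x _ => mul_nonneg (hμ _) (convPow_nonneg μ hμ n _))
      refine Finset.sum_le_sum fun x _ => ?_
      exact mul_le_mul (ha x) (ih _) (pos _ _) (hμ _)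
  have sym : ∀ n g, (a ^ n).coeff g⁻¹ = (a ^ n).coeff g := by
    intro n
    induction n with
    | zero =>
      intro g
      rw [pow_zero, MonoidAlgebra.one_def, MonoidAlgebra.coeff_single, Finsupp.single_apply, Finsupp.single_apply]
      simp [eq_comm]
    | succ n ih =>
      intro g
      rw [pow_succ', MonoidAlgebra.coeff_mul_apply_left, ← pow_succ', pow_succ,
        MonoidAlgebra.coeff_mul_apply_right]
      refine Finset.sum_nbij' (fun x => x⁻¹) (fun x => x⁻¹) ?_ ?_ ?_ ?_ ?_
      · intro x hx; simpa [hsym] using hx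
      · intro x hx; simpa [hsym] using hx
      · simp
      · simp
      · intro x hx
        simp only [hsym, inv_inv]
        rw [mul_comm, ← ih (g * x)]; simp
  have sup : ∀ n, ((a ^ n).coeff.support : Set G) ⊆ V ^ n := by
    intro n
    induction n with
    | zero =>
      intro g hg
      rw [pow_zero, MonoidAlgebra.one_def] at hg
      simp only [Finset.mem_coe, Finsupp.mem_support_iff, MonoidAlgebra.coeff_single, Finsupp.single_apply] at hg
      simp only [pow_zero, Set.mem_one]
      by_contra hne
      exact hg (if_neg fun h => hne h.symm)
    | succ n ih =>
      intro g hg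
      simp only [Finset.mem_coe, Finsupp.mem_support_iff] at hg
      rw [pow_succ', MonoidAlgebra.coeff_mul_apply_left] at hg
      obtain ⟨x, hx, hne⟩ := Finset.exists_ne_zero_of_sum_ne_zero hg
      rw [pow_succ']
      refine Set.mem_mul.2 ⟨x, hV hx, x⁻¹ * g, ih ?_, by group⟩
      simp only [Finset.mem_coe, Finsupp.mem_support_iff]
      exact right_ne_zero_of_mul hne
  have mass : ((a ^ n).coeff.sum fun _ r => r) = (a.coeff.sum fun _ r => r) ^ n := by
    have e : ∀ b : MonoidAlgebra ℝ G, (b.coeff.sum fun _ r => r) =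
        MonoidAlgebra.lift ℝ ℝ G (1 : G →* ℝ) b := by
      intro b; rw [MonoidAlgebra.lift_apply]; simp
    rw [e, e, map_pow]
  have supF : (a ^ n).coeff.support ⊆ F := fun x hx => hF (sup n hx)
  have m1 : (∑ x ∈ F, (a ^ n).coeff x) = (a.coeff.sum fun _ r => r) ^ n := by
    rw [← mass]
    exact (Finset.sum_subset supF fun x _ hx => by simpa using hx).symm
  have m2 : (∑ x ∈ F, (a ^ n).coeff x ^ 2) = (a ^ (2 * n)).coeff 1 := by
    rw [two_mul, pow_add, MonoidAlgebra.coeff_mul_apply_left, Finsupp.sum]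
    rw [← Finset.sum_subset supF (fun x _ hx => by
      have : (a ^ n).coeff x = 0 := by simpa using hx
      rw [this]; simp)]
    refine Finset.sum_congr rfl fun x _ => ?_
    rw [mul_one, sym, sq]
  have cs := Finset.sum_mul_sq_le_sq_mul_sq F (fun _ => (1:ℝ)) (fun x => (a ^ n).coeff x)
  simp only [one_mul, one_pow, Finset.sum_const, nsmul_eq_mul, mul_one] at cs
  rw [m1, m2, ← pow_mul, mul_comm n 2] at cs
  exact cs.trans (mul_le_mul_of_nonneg_left (le _ _) (Nat.cast_nonneg _))

lemma convPow_mul_le {G : Type*} [Group G] (μ : G → ℝ) (hμ : ∀ g, 0 ≤ μ g) (h1 : HasSum μ 1)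
    (n : ℕ) : μ 1 * convPow μ n 1 ≤ convPow μ (n + 1) 1 := by
  have s1 := summable_conv μ _ hμ (convPow_nonneg μ hμ n) h1.summable (convPow_le_one μ hμ h1 n) 1
  have := s1.le_tsum 1 fun x _ => mul_nonneg (hμ _) (convPow_nonneg μ hμ n _)
  simpa [convPow, conv] using this


lemma gen_nonneg {G : Type*} [Group G] {k : ℕ} (s : Fin k → G) (w : ℤ → ℝ) (hw : ∀ m, 0 ≤ w m)
    (g : G) : 0 ≤ genMeasure s w g := by
  unfold genMeasure
  refine mul_nonneg (by positivity) (Finset.sum_nonneg fun i _ => tsum_nonneg fun m => ?_)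
  split_ifs
  · exact hw m
  · exact le_rfl

lemma gen_hasSum {G : Type*} [Group G] {k : ℕ} (hk : 0 < k) (s : Fin k → G) (w : ℤ → ℝ)
    (h1 : HasSum w 1) : HasSum (genMeasure s w) 1 := by
  have h2 : ∀ i ∈ (Finset.univ : Finset (Fin k)),
      HasSum (fun g => ∑' n : ℤ, if g = s i ^ n then w n else 0) 1 := by
    intro i _
    have := hasSum_push (fun n : ℤ => s i ^ n) w h1.summable
    rwa [h1.tsum_eq] at this
  have h3 := (hasSum_sum h2).mul_left (k : ℝ)⁻¹
  have hk' : (k : ℝ) ≠ 0 := by positivity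
  simp only [Finset.sum_const, Finset.card_univ, Fintype.card_fin, nsmul_eq_mul, mul_one,
    inv_mul_cancel₀ hk'] at h3
  exact h3

lemma summable_ite_of {w : ℤ → ℝ} (h1 : Summable w) (p : ℤ → Prop) :
    Summable (fun m => if p m then w m else 0) := by
  refine (h1.indicator {m | p m}).congr fun n => ?_
  simp [Set.indicator_apply]

lemma gen_one {G : Type*} [Group G] {k : ℕ} (hk : 0 < k) (s : Fin k → G) (w : ℤ → ℝ)
    (hw : ∀ m, 0 ≤ w m) (h1 : HasSum w 1) : w 0 ≤ genMeasure s w 1 := by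
  have hk' : (k : ℝ) ≠ 0 := by positivity
  have h2 : ∀ i ∈ (Finset.univ : Finset (Fin k)),
      w 0 ≤ ∑' n : ℤ, if 1 = s i ^ n then w n else 0 := by
    intro i _
    have := (summable_ite_of h1.summable fun n => 1 = s i ^ n).le_tsum 0 (fun m _ => by
      split_ifs
      · exact hw m
      · exact le_rfl)
    simpa using this
  have h3 := Finset.sum_le_sum h2
  simp only [Finset.sum_const, Finset.card_univ, Fintype.card_fin, nsmul_eq_mul] at h3
  have h4 := mul_le_mul_of_nonneg_left h3 (by positivity : 0 ≤ (k : ℝ)⁻¹)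
  rwa [inv_mul_cancel_left₀ hk'] at h4

lemma gen_upper {G : Type*} [Group G] {k : ℕ} (hk : 0 < k) (s : Fin k → G) (w : ℤ → ℝ)
    (hw : ∀ m, 0 ≤ w m) (h1 : HasSum w 1) (i : Fin k) (hi : ∀ m : ℤ, m ≠ 0 → s i ^ m ≠ 1)
    (p : ℤ → Prop) (B : ℝ) (hB0 : 0 ≤ B) (hB : ∀ m, p m → w m ≤ B) (h : ℝ) (hh : 0 < h)
    (hh2 : HasSum (fun m => if p m then w m else 0) h) (n : ℕ) :
    convPow (genMeasure s w) n 1 ≤ (1 - h / k) ^ n + B / h := by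
  have hk' : (0 : ℝ) < k := by positivity
  have hk1 : (1 : ℝ) ≤ k := by exact_mod_cast hk
  set v : ℤ → ℝ := fun m => if p m then w m else 0 with hv
  have hv0 : ∀ m, 0 ≤ v m := fun m => by
    simp only [hv]; split_ifs
    · exact hw m
    · exact le_rfl
  have hvw : ∀ m, v m ≤ w m := fun m => by
    simp only [hv]; split_ifs
    · exact le_rfl
    · exact hw m
  have hvB : ∀ m, v m ≤ B := fun m => by
    simp only [hv]; split_ifs with hp
    · exact hB m hp
    · exact hB0
  have hle1 : h ≤ 1 := hasSum_le hvw hh2 h1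
  set β : G → ℝ := fun g => (k : ℝ)⁻¹ * ∑' m : ℤ, if g = s i ^ m then v m else 0 with hβ
  have hβ0 : ∀ g, 0 ≤ β g := fun g => by
    refine mul_nonneg (by positivity) (tsum_nonneg fun m => ?_)
    split_ifs
    · exact hv0 m
    · exact le_rfl
  have hβs : HasSum β (h / k) := by
    have := (hasSum_push (fun n : ℤ => s i ^ n) v hh2.summable).mul_left (k : ℝ)⁻¹
    rw [hh2.tsum_eq] at this
    rw [div_eq_inv_mul]; exact this
  have hβμ : ∀ g, β g ≤ genMeasure s w g := by
    intro g
    refine mul_le_mul_of_nonneg_left ?_ (by positivity)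
    have t1 : (∑' m : ℤ, if g = s i ^ m then v m else 0) ≤ ∑' m : ℤ, if g = s i ^ m then w m else 0 := by
      refine (summable_ite_of hh2.summable _).tsum_le_tsum (fun m => ?_) (summable_ite_of h1.summable _)
      split_ifs
      · exact hvw m
      · exact le_rfl
    refine t1.trans ?_
    refine Finset.single_le_sum (f := fun i => ∑' m : ℤ, if g = s i ^ m then w m else 0)
      (fun j _ => tsum_nonneg fun m => ?_) (Finset.mem_univ i)
    split_ifs
    · exact hw m
    · exact le_rfl
  have hinj : ∀ m m' : ℤ, s i ^ m = s i ^ m' → m = m' := by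
    intro m m' hmm
    by_contra hne
    refine hi (m - m') (sub_ne_zero.2 hne) ?_
    rw [zpow_sub, hmm, mul_inv_cancel]
  have hβB : ∀ g, β g ≤ B / k := by
    intro g
    rw [div_eq_inv_mul]
    refine mul_le_mul_of_nonneg_left ?_ (by positivity)
    by_cases hg : ∃ m : ℤ, g = s i ^ m
    · obtain ⟨m, rfl⟩ := hg
      rw [tsum_eq_single m fun m' hm' => if_neg fun e => hm' (hinj _ _ e).symm]
      simpa using hvB m
    · push Not at hg
      have : ∀ m : ℤ, (if g = s i ^ m then v m else 0) = 0 := fun m => if_neg (hg m)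
      simp only [this, tsum_zero]; exact hB0
  have := upper_gen (genMeasure s w) (fun g => genMeasure s w g - β g) β
    (fun g => sub_nonneg.2 (hβμ g)) hβ0 (fun g => by ring) (gen_hasSum hk s w h1) (h / k) (B / k)
    (by positivity) ((div_le_one hk').2 (hle1.trans hk1)) hβs hβB n 1
  rwa [div_div_div_cancel_right₀ hk'.ne'] at this

lemma gen_lower {G : Type*} [Group G] {k : ℕ} (hk : 0 < k) (s : Fin k → G) (w : ℤ → ℝ)
    (hw : ∀ m, 0 ≤ w m) (hsymm : ∀ m, w (-m) = w m) (h1 : HasSum w 1)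
    (R n : ℕ) (F : Finset G) (hF : gT (Set.range s) ^ (R * n) ⊆ (F : Set G)) :
    (∑ m ∈ Finset.Icc (-(R:ℤ)) R, w m) ^ (2 * n) ≤ F.card * convPow (genMeasure s w) (2 * n) 1 := by
  have hk' : (k : ℝ) ≠ 0 := by positivity
  set a : MonoidAlgebra ℝ G := ∑ i : Fin k, ∑ m ∈ Finset.Icc (-(R:ℤ)) R,
    MonoidAlgebra.single (s i ^ m) ((k:ℝ)⁻¹ * w m) with ha
  have hcoef : ∀ g, a.coeff g = ∑ i : Fin k, ∑ m ∈ Finset.Icc (-(R:ℤ)) R,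
      if g = s i ^ m then (k:ℝ)⁻¹ * w m else 0 := by
    intro g
    simp only [ha, MonoidAlgebra.coeff_sum, MonoidAlgebra.coeff_single, Finsupp.finsetSum_apply,
      Finsupp.single_apply, eq_comm]
  have hsum : (a.coeff.sum fun _ r => r) = ∑ m ∈ Finset.Icc (-(R:ℤ)) R, w m := by
    have e : (a.coeff.sum fun _ r => r) =
        MonoidAlgebra.lift ℝ ℝ G (1 : G →* ℝ) a := by
      rw [MonoidAlgebra.lift_apply]; simp
    rw [e, ha]
    simp only [map_sum, MonoidAlgebra.lift_single]
    simp [← Finset.mul_sum, hk']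
  rw [← hsum]
  refine lower_gen _ (gen_nonneg s w hw) (gen_hasSum hk s w h1) a ?_ ?_ ?_ n F
    (gT (Set.range s) ^ R) ?_ (by rw [← pow_mul]; exact hF)
  · intro g
    rw [hcoef]
    refine Finset.sum_nonneg fun i _ => Finset.sum_nonneg fun m _ => ?_
    split_ifs
    · exact mul_nonneg (by positivity) (hw m)
    · exact le_rfl
  · intro g
    rw [hcoef]
    unfold genMeasure
    rw [Finset.mul_sum]
    refine Finset.sum_le_sum fun i _ => ?_
    have := (summable_ite_of h1.summable fun n => g = s i ^ n).sum_le_tsum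
      (Finset.Icc (-(R:ℤ)) R) (fun m _ => by
        split_ifs
        · exact hw m
        · exact le_rfl)
    refine le_trans (le_of_eq ?_) (mul_le_mul_of_nonneg_left this (by positivity))
    rw [Finset.mul_sum]
    refine Finset.sum_congr rfl fun m _ => ?_
    split_ifs <;> simp
  · intro g
    rw [hcoef, hcoef]
    refine Finset.sum_congr rfl fun i _ => ?_
    refine Finset.sum_nbij' (fun x => -x) (fun x => -x) ?_ ?_ ?_ ?_ ?_
    · intro x hx; rw [Finset.mem_Icc] at hx ⊢; omega
    · intro x hx; rw [Finset.mem_Icc] at hx ⊢; omega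
    · simp
    · simp
    · intro x _
      rw [hsymm, zpow_neg]
      simp only [inv_eq_iff_eq_inv]
  · intro g hg
    simp only [Finset.mem_coe, Finsupp.mem_support_iff] at hg
    rw [hcoef] at hg
    obtain ⟨i, _, hne⟩ := Finset.exists_ne_zero_of_sum_ne_zero hg
    obtain ⟨m, hm, hne⟩ := Finset.exists_ne_zero_of_sum_ne_zero hne
    have hgm : g = s i ^ m := by
      by_contra h; exact hne (if_neg h)
    rw [Finset.mem_Icc] at hm
    have hs : s i ∈ gT (Set.range s) := gT_sub _ ⟨i, rfl⟩
    have hp : ∀ j : ℕ, s i ^ j ∈ gT (Set.range s) ^ j := fun j => Set.pow_mem_pow hs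
    rw [hgm]
    rcases Int.eq_nat_or_neg m with ⟨j, rfl | rfl⟩
    · rw [zpow_natCast]; exact gT_pow_mono _ (by omega) (hp j)
    · rw [zpow_neg, zpow_natCast]
      exact gT_pow_inv _ _ (gT_pow_mono _ (by omega) (hp j))

end ProbB

section AnaC

def qf (l : ℝ → ℝ) (t : ℝ) : ℝ := 1 / (t * l (1 / t))

def If (l : ℝ → ℝ) (a : ℝ) : ℝ := ∫ t in Set.Ioc (0:ℝ) a, qf l t

def ff (l : ℝ → ℝ) (n : ℕ) : ℝ := 1 / ((1 + (n:ℝ)) * l (1 + (n:ℝ) ^ 2))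

lemma qf_pos {l : ℝ → ℝ} (hp : ∀ x, 0 ≤ x → 0 < l x) {t : ℝ} (ht : 0 < t) : 0 < qf l t := by
  have := hp (1 / t) (by positivity)
  unfold qf; positivity

lemma ff_pos {l : ℝ → ℝ} (hp : ∀ x, 0 ≤ x → 0 < l x) (n : ℕ) : 0 < ff l n := by
  have := hp (1 + (n:ℝ)^2) (by positivity)
  unfold ff; positivity

lemma ff_anti {l : ℝ → ℝ} (hp : ∀ x, 0 ≤ x → 0 < l x) (hm : MonotoneOn l (Set.Ici 0)) {m n : ℕ}
    (h : m ≤ n) : ff l n ≤ ff l m := by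
  have h0 := hp (1 + (m:ℝ)^2) (by positivity)
  have hmn : (m:ℝ) ≤ n := by exact_mod_cast h
  have h2 : l (1 + (m:ℝ)^2) ≤ l (1 + (n:ℝ)^2) :=
    hm (by simp; positivity) (by simp; positivity) (by gcongr)
  unfold ff
  exact one_div_le_one_div_of_le (by positivity) (by gcongr)

lemma qf_cont {l : ℝ → ℝ} (hl : ContinuousOn l (Set.Ici 0)) (hp : ∀ x, 0 ≤ x → 0 < l x) :
    ContinuousOn (qf l) (Set.Ioi 0) := by
  have h1 : ContinuousOn (fun t : ℝ => 1 / t) (Set.Ioi 0) :=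
    continuousOn_const.div continuousOn_id fun x hx => ne_of_gt hx
  have h2 : ContinuousOn (fun t : ℝ => l (1 / t)) (Set.Ioi 0) :=
    hl.comp h1 fun x hx => by
      have : (0:ℝ) < x := hx
      simp; positivity
  refine continuousOn_const.div (continuousOn_id.mul h2) fun x hx => ?_
  have hx' : (0:ℝ) < x := hx
  have := hp (1 / x) (by positivity)
  show x * l (1 / x) ≠ 0
  positivity

lemma qf_int {l : ℝ → ℝ} (hl : ContinuousOn l (Set.Ici 0)) (hp : ∀ x, 0 ≤ x → 0 < l x)
    (hi : IntegrableOn (fun t => 1 / (t * l (1 / t))) (Set.Ioc 0 1)) (a : ℝ) :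
    IntegrableOn (qf l) (Set.Ioc 0 a) := by
  have h1 : IntegrableOn (qf l) (Set.Icc 1 a) :=
    ((qf_cont hl hp).mono fun x hx => lt_of_lt_of_le one_pos hx.1).integrableOn_Icc
  refine (IntegrableOn.union (s := Set.Ioc 0 1) hi h1).mono_set ?_
  intro x hx
  rcases le_total x 1 with h | h
  · exact Or.inl ⟨hx.1, h⟩
  · exact Or.inr ⟨h, hx.2⟩

lemma If_sub {l : ℝ → ℝ} (hl : ContinuousOn l (Set.Ici 0)) (hp : ∀ x, 0 ≤ x → 0 < l x)
    (hi : IntegrableOn (fun t => 1 / (t * l (1 / t))) (Set.Ioc 0 1)) {a b : ℝ} (hb : 0 < b)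
    (hab : b ≤ a) : If l a - If l b = ∫ t in Set.Ioc b a, qf l t := by
  have e : Set.Ioc 0 a = Set.Ioc 0 b ∪ Set.Ioc b a := (Set.Ioc_union_Ioc_eq_Ioc hb.le hab).symm
  have := qf_int hl hp hi a
  unfold If
  rw [e, setIntegral_union (Set.Ioc_disjoint_Ioc_of_le le_rfl) measurableSet_Ioc
    (qf_int hl hp hi b) (this.mono_set (Set.Ioc_subset_Ioc_left hb.le))]
  ring

lemma If_sub_le {l : ℝ → ℝ} (hl : ContinuousOn l (Set.Ici 0)) (hp : ∀ x, 0 ≤ x → 0 < l x)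
    (hi : IntegrableOn (fun t => 1 / (t * l (1 / t))) (Set.Ioc 0 1)) {a b M : ℝ} (hb : 0 < b)
    (hab : b ≤ a) (hM : ∀ t ∈ Set.Ioc b a, qf l t ≤ M) : If l a - If l b ≤ (a - b) * M := by
  rw [If_sub hl hp hi hb hab]
  have h1 : IntegrableOn (qf l) (Set.Ioc b a) :=
    (qf_int hl hp hi a).mono_set (Set.Ioc_subset_Ioc_left hb.le)
  have := setIntegral_mono_on h1 (integrableOn_const (by simp) (C := M)) measurableSet_Ioc hM
  simpa [hab] using this

lemma le_If_sub {l : ℝ → ℝ} (hl : ContinuousOn l (Set.Ici 0)) (hp : ∀ x, 0 ≤ x → 0 < l x)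
    (hi : IntegrableOn (fun t => 1 / (t * l (1 / t))) (Set.Ioc 0 1)) {a b M : ℝ} (hb : 0 < b)
    (hab : b ≤ a) (hM : ∀ t ∈ Set.Ioc b a, M ≤ qf l t) : (a - b) * M ≤ If l a - If l b := by
  rw [If_sub hl hp hi hb hab]
  have h1 : IntegrableOn (qf l) (Set.Ioc b a) :=
    (qf_int hl hp hi a).mono_set (Set.Ioc_subset_Ioc_left hb.le)
  have := setIntegral_mono_on (integrableOn_const (by simp) (C := M)) h1 measurableSet_Ioc hM
  simpa [hab] using this

lemma qf_anti_bd {l : ℝ → ℝ} (hp : ∀ x, 0 ≤ x → 0 < l x) (hm : MonotoneOn l (Set.Ici 0))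
    {a b t : ℝ} (hb : 0 < b) (ht : t ∈ Set.Ioc b a) :
    1 / (a * l (1 / b)) ≤ qf l t ∧ qf l t ≤ 1 / (b * l (1 / a)) := by
  have ht0 : 0 < t := hb.trans ht.1
  have ha0 : 0 < a := ht0.trans_le ht.2
  have l1 := hp (1 / t) (by positivity)
  have l2 := hp (1 / a) (by positivity)
  have m1 : l (1 / t) ≤ l (1 / b) := hm (by simp; positivity) (by simp; positivity)
    (one_div_le_one_div_of_le hb ht.1.le)
  have m2 : l (1 / a) ≤ l (1 / t) := hm (by simp; positivity) (by simp; positivity)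
    (one_div_le_one_div_of_le ht0 ht.2)
  unfold qf
  constructor
  · exact one_div_le_one_div_of_le (by positivity) (mul_le_mul ht.2 m1 l1.le ha0.le)
  · exact one_div_le_one_div_of_le (by positivity) (mul_le_mul ht.1.le m2 l2.le ht0.le)

lemma If_strict {l : ℝ → ℝ} (hl : ContinuousOn l (Set.Ici 0)) (hp : ∀ x, 0 ≤ x → 0 < l x)
    (hm : MonotoneOn l (Set.Ici 0))
    (hi : IntegrableOn (fun t => 1 / (t * l (1 / t))) (Set.Ioc 0 1)) {a b : ℝ} (hb : 0 < b)
    (hab : b < a) : If l b < If l a := by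
  have := le_If_sub hl hp hi hb hab.le (fun t ht => (qf_anti_bd hp hm hb ht).1)
  have l2 := hp (1 / b) (by positivity)
  have h3 : 0 < (a - b) * (1 / (a * l (1 / b))) := by
    have : 0 < a - b := sub_pos.2 hab
    have : 0 < a := hb.trans hab
    positivity
  linarith

lemma If_nonneg {l : ℝ → ℝ} (hp : ∀ x, 0 ≤ x → 0 < l x) (a : ℝ) : 0 ≤ If l a :=
  setIntegral_nonneg measurableSet_Ioc fun t ht => (qf_pos hp ht.1).le

lemma If_pos {l : ℝ → ℝ} (hl : ContinuousOn l (Set.Ici 0)) (hp : ∀ x, 0 ≤ x → 0 < l x)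
    (hm : MonotoneOn l (Set.Ici 0))
    (hi : IntegrableOn (fun t => 1 / (t * l (1 / t))) (Set.Ioc 0 1)) {a : ℝ} (ha : 0 < a) :
    0 < If l a :=
  (If_nonneg hp (a / 2)).trans_lt (If_strict hl hp hm hi (by positivity) (by linarith))

lemma If_tendsto {l : ℝ → ℝ}
    (hi : IntegrableOn (fun t => 1 / (t * l (1 / t))) (Set.Ioc 0 1)) :
    Tendsto (If l) (𝓝[>] 0) (𝓝 0) := by
  have h1 : ContinuousOn (fun x => ∫ t in Set.Ioc (0:ℝ) x, qf l t) (Set.Icc 0 1) := by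
    apply intervalIntegral.continuousOn_primitive
    rw [integrableOn_Icc_iff_integrableOn_Ioc]; exact hi
  have h2 := h1 0 (by simp)
  have h3 : Tendsto (If l) (𝓝[Set.Icc 0 1] 0) (𝓝 (If l 0)) := h2
  have h4 : If l 0 = 0 := by simp [If]
  rw [h4] at h3
  refine h3.mono_left ?_
  rw [← nhdsWithin_Ioc_eq_nhdsGT (zero_lt_one : (0:ℝ) < 1)]
  exact nhdsWithin_mono _ Set.Ioc_subset_Icc_self

lemma If_hasSum {l : ℝ → ℝ} (hl : ContinuousOn l (Set.Ici 0)) (hp : ∀ x, 0 ≤ x → 0 < l x)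
    (hm : MonotoneOn l (Set.Ici 0))
    (hi : IntegrableOn (fun t => 1 / (t * l (1 / t))) (Set.Ioc 0 1))
    (p : ℕ → ℝ) (p0 : ∀ n, 0 < p n) (pa : ∀ n, p (n+1) < p n) (pt : Tendsto p atTop (𝓝 0)) :
    HasSum (fun n => If l (p n) - If l (p (n+1))) (If l (p 0)) := by
  rw [hasSum_iff_tendsto_nat_of_nonneg]
  · simp only [Finset.sum_range_sub']
    have : Tendsto p atTop (𝓝[>] 0) := tendsto_nhdsWithin_iff.2 ⟨pt, Eventually.of_forall p0⟩
    have h2 := (If_tendsto hi).comp this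
    simpa using (tendsto_const_nhds (x := If l (p 0))).sub h2
  · intro n
    exact sub_nonneg.2 (If_strict hl hp hm hi (p0 _) (pa n)).le

lemma ptend (c : ℝ) (hc : 0 < c) (R : ℕ) :
    Tendsto (fun j : ℕ => 1 / (c * ((R:ℝ) + j)) ^ 2) atTop (𝓝 0) := by
  have h1 : Tendsto (fun j : ℕ => c * ((R:ℝ) + j)) atTop atTop :=
    (tendsto_atTop_add_const_left _ _ tendsto_natCast_atTop_atTop).const_mul_atTop hc
  have h2 := (tendsto_pow_atTop (α := ℝ) (n := 2) (by norm_num)).comp h1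
  have := tendsto_inv_atTop_zero.comp h2
  refine this.congr fun j => ?_
  simp [one_div]

lemma part_hasSum {l : ℝ → ℝ} (hl : ContinuousOn l (Set.Ici 0)) (hp : ∀ x, 0 ≤ x → 0 < l x)
    (hm : MonotoneOn l (Set.Ici 0))
    (hi : IntegrableOn (fun t => 1 / (t * l (1 / t))) (Set.Ioc 0 1))
    (c : ℝ) (hc : 0 < c) (R : ℕ) (hR : 1 ≤ R) :
    HasSum (fun j : ℕ => If l (1 / (c * ((R + j : ℕ):ℝ)) ^ 2) -
      If l (1 / (c * (((R + j : ℕ):ℝ) + 1)) ^ 2)) (If l (1 / (c * R) ^ 2)) := by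
  have hR' : (1:ℝ) ≤ R := by exact_mod_cast hR
  have := If_hasSum hl hp hm hi (fun j : ℕ => 1 / (c * ((R:ℝ) + j)) ^ 2)
    (fun n => by positivity)
    (fun n => by
      apply one_div_lt_one_div_of_lt (by positivity)
      push_cast
      gcongr
      linarith) (ptend c hc R)
  simpa [add_assoc] using this

lemma block_lower {l : ℝ → ℝ} (hl : ContinuousOn l (Set.Ici 0)) (hp : ∀ x, 0 ≤ x → 0 < l x)
    (hm : MonotoneOn l (Set.Ici 0))
    (hi : IntegrableOn (fun t => 1 / (t * l (1 / t))) (Set.Ioc 0 1)) (m : ℕ) (h1 : 1 ≤ m) :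
    ff l (m + 1) ≤ If l (1 / (1 * (m:ℝ)) ^ 2) - If l (1 / (1 * ((m:ℝ) + 1)) ^ 2) := by
  have hm1 : (1:ℝ) ≤ m := by exact_mod_cast h1
  have hb : (0:ℝ) < 1 / (1 * ((m:ℝ) + 1)) ^ 2 := by positivity
  have hab : 1 / (1 * ((m:ℝ) + 1)) ^ 2 ≤ 1 / (1 * (m:ℝ)) ^ 2 := by
    apply one_div_le_one_div_of_le (by positivity); gcongr <;> linarith
  refine le_trans ?_ (le_If_sub hl hp hi hb hab fun t ht => (qf_anti_bd hp hm hb ht).1)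
  rw [one_div_one_div]
  have l0 := hp ((1 * ((m:ℝ) + 1)) ^ 2) (by positivity)
  have l1 : l ((1 * ((m:ℝ) + 1)) ^ 2) ≤ l (1 + ((m+1 : ℕ):ℝ)^2) :=
    hm (by simp; positivity) (by simp; positivity) (by push_cast; linarith)
  unfold ff
  set A := l ((1 * ((m:ℝ) + 1)) ^ 2)
  set B := l (1 + ((m+1 : ℕ):ℝ)^2)
  have e : (1 / (1 * (m:ℝ)) ^ 2 - 1 / (1 * ((m:ℝ) + 1)) ^ 2) * (1 / (1 / (1 * (m:ℝ)) ^ 2 * A))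
      = (2 * m + 1) / ((m + 1) ^ 2 * A) := by
    field_simp; ring
  rw [e]
  calc 1 / ((1 + ((m+1 : ℕ):ℝ)) * B) ≤ 1 / ((1 + m) * A) := by
        apply one_div_le_one_div_of_le (by positivity)
        push_cast
        gcongr; linarith
    _ ≤ _ := by
        rw [div_le_div_iff₀ (by positivity) (by positivity)]
        have : 0 ≤ A * (m * (m + 1)) := by positivity
        nlinarith

lemma block_upper {l : ℝ → ℝ} (hl : ContinuousOn l (Set.Ici 0)) (hp : ∀ x, 0 ≤ x → 0 < l x)
    (hm : MonotoneOn l (Set.Ici 0))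
    (hi : IntegrableOn (fun t => 1 / (t * l (1 / t))) (Set.Ioc 0 1)) (m : ℕ) (h1 : 1 ≤ m) :
    If l (1 / (2 * (m:ℝ)) ^ 2) - If l (1 / (2 * ((m:ℝ) + 1)) ^ 2) ≤ 6 * ff l m := by
  have hm1 : (1:ℝ) ≤ m := by exact_mod_cast h1
  have hb : (0:ℝ) < 1 / (2 * ((m:ℝ) + 1)) ^ 2 := by positivity
  have hab : 1 / (2 * ((m:ℝ) + 1)) ^ 2 ≤ 1 / (2 * (m:ℝ)) ^ 2 := by
    apply one_div_le_one_div_of_le (by positivity); gcongr <;> linarith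
  refine le_trans (If_sub_le hl hp hi hb hab fun t ht => (qf_anti_bd hp hm hb ht).2) ?_
  rw [one_div_one_div]
  have l0 := hp (1 + (m:ℝ)^2) (by positivity)
  have l1 : l (1 + (m:ℝ)^2) ≤ l ((2 * (m:ℝ)) ^ 2) :=
    hm (by simp; positivity) (by rw [Set.mem_Ici]; positivity) (by nlinarith)
  unfold ff
  set A := l ((2 * (m:ℝ)) ^ 2)
  set B := l (1 + (m:ℝ)^2)
  have hA : 0 < A := l0.trans_le l1
  have e : (1 / (2 * (m:ℝ)) ^ 2 - 1 / (2 * ((m:ℝ) + 1)) ^ 2) * (1 / (1 / (2 * ((m:ℝ) + 1)) ^ 2 * A))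
      = (2 * m + 1) / (m ^ 2 * A) := by
    field_simp; ring
  rw [e]
  calc (2 * m + 1) / (m ^ 2 * A) ≤ (2 * m + 1) / (m ^ 2 * B) := by gcongr
    _ ≤ 6 * (1 / ((1 + m) * B)) := by
        rw [mul_one_div, div_le_div_iff₀ (by positivity) (by positivity)]
        have : (2 * (m:ℝ) + 1) * (1 + m) ≤ 6 * m ^ 2 := by nlinarith
        nlinarith

lemma ff_summable {l : ℝ → ℝ} (hl : ContinuousOn l (Set.Ici 0)) (hp : ∀ x, 0 ≤ x → 0 < l x)
    (hm : MonotoneOn l (Set.Ici 0))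
    (hi : IntegrableOn (fun t => 1 / (t * l (1 / t))) (Set.Ioc 0 1)) : Summable (ff l) := by
  rw [← summable_nat_add_iff 2]
  have h := (part_hasSum hl hp hm hi 1 one_pos 1 le_rfl).summable
  refine Summable.of_nonneg_of_le (fun n => (ff_pos hp _).le) (fun n => ?_) h
  have := block_lower hl hp hm hi (1 + n) (by omega)
  convert this using 2
  omega

lemma ff_tail_le {l : ℝ → ℝ} (hl : ContinuousOn l (Set.Ici 0)) (hp : ∀ x, 0 ≤ x → 0 < l x)
    (hm : MonotoneOn l (Set.Ici 0))
    (hi : IntegrableOn (fun t => 1 / (t * l (1 / t))) (Set.Ioc 0 1)) (R : ℕ) (hR : 1 ≤ R) :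
    ∑' j, ff l (R + j + 1) ≤ If l (1 / (R:ℝ) ^ 2) := by
  have h := part_hasSum hl hp hm hi 1 one_pos R hR
  rw [one_mul] at h
  rw [← h.tsum_eq]
  refine Summable.tsum_le_tsum (fun n => block_lower hl hp hm hi (R + n) (by omega)) ?_ h.summable
  have := (summable_nat_add_iff (R + 1)).2 (ff_summable hl hp hm hi)
  refine this.congr fun j => by congr 1; omega

lemma le_ff_tail {l : ℝ → ℝ} (hl : ContinuousOn l (Set.Ici 0)) (hp : ∀ x, 0 ≤ x → 0 < l x)
    (hm : MonotoneOn l (Set.Ici 0))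
    (hi : IntegrableOn (fun t => 1 / (t * l (1 / t))) (Set.Ioc 0 1)) (R : ℕ) (hR : 1 ≤ R) :
    If l (1 / (2 * (R:ℝ)) ^ 2) ≤ 6 * ∑' j, ff l (R + j) := by
  have h := part_hasSum hl hp hm hi 2 two_pos R hR
  rw [← h.tsum_eq, ← tsum_mul_left]
  refine Summable.tsum_le_tsum (fun n => block_upper hl hp hm hi (R + n) (by omega)) h.summable ?_
  refine Summable.mul_left _ ?_
  have := (summable_nat_add_iff R).2 (ff_summable hl hp hm hi)
  refine this.congr fun j => by congr 1; omega

lemma theta_eq (l : ℝ → ℝ) (u : ℝ) : thetaOf l (Real.exp u) = 1 / If l (Real.exp (-u)) := by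
  unfold thetaOf If qf
  rw [Real.exp_neg, one_div (Real.exp u)]

end AnaC

section AbsD

lemma sv_le {f : ℝ → ℝ} (hf : SlowlyVarying f) (hp : ∀ x, 0 ≤ x → 0 < f x) {c a : ℝ} (hc : 0 < c)
    (ha : 1 < a) : ∀ᶠ x in atTop, f (c * x) ≤ a * f x := by
  filter_upwards [(hf c hc).eventually_lt_const ha, eventually_ge_atTop 0] with x h1 h2
  have := hp x h2
  exact ((div_lt_iff₀ this).1 h1).le

lemma sv_ge {f : ℝ → ℝ} (hf : SlowlyVarying f) (hp : ∀ x, 0 ≤ x → 0 < f x) {c : ℝ} (hc : 0 < c) :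
    ∀ᶠ x in atTop, f x ≤ 2 * f (c * x) := by
  filter_upwards [(hf c hc).eventually_const_lt (show (1/2:ℝ) < 1 by norm_num),
    eventually_ge_atTop 0] with x h1 h2
  have := hp x h2
  have := ((lt_div_iff₀ this).1 h1).le
  linarith

lemma kap_sqrt {f : ℝ → ℝ} (hf : SlowlyVarying f) (hp : ∀ x, 0 < f x) (hm : Monotone f) :
    ∃ C : ℝ, 0 < C ∧ ∀ᶠ x in atTop, f x ≤ C * √x := by
  have h := sv_le hf (fun x _ => hp x) (c := 2) (a := √2) (by norm_num)
    (by rw [Real.lt_sqrt] <;> norm_num)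
  obtain ⟨X, hX⟩ := eventually_atTop.1 (h.and (eventually_ge_atTop (1:ℝ)))
  have hX1 : 1 ≤ X := (hX X le_rfl).2
  have hXs : 0 < √X := Real.sqrt_pos.2 (by linarith)
  set C := f (2 * X) / √X with hC
  have hCp : 0 < C := div_pos (hp _) hXs
  refine ⟨C, hCp, ?_⟩
  have base : ∀ x, X ≤ x → x ≤ 2 * X → f x ≤ C * √x := by
    intro x h1 h2
    have e : f (2 * X) = C * √X := by rw [hC]; field_simp
    calc f x ≤ f (2 * X) := hm h2
      _ = C * √X := e
      _ ≤ C * √x := by gcongr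
  have key : ∀ n : ℕ, ∀ x, X ≤ x → x ≤ 2 ^ n * X → f x ≤ C * √x := by
    intro n
    induction n with
    | zero => intro x h1 h2; exact base x h1 (by linarith)
    | succ n ih =>
      intro x h1 h2
      by_cases h3 : x ≤ 2 * X
      · exact base x h1 h3
      · push Not at h3
        have h4 : X ≤ x / 2 := by linarith
        have h5 := ih (x / 2) h4 (by rw [pow_succ] at h2; linarith)
        have h6 := (hX (x / 2) h4).1
        rw [show 2 * (x / 2) = x by ring] at h6
        have e : √x = √2 * √(x / 2) := by
          rw [← Real.sqrt_mul (by norm_num)]; congr 1; ring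
        calc f x ≤ √2 * f (x / 2) := h6
          _ ≤ √2 * (C * √(x / 2)) := by gcongr
          _ = C * √x := by rw [e]; ring
  filter_upwards [eventually_ge_atTop X] with x hx
  obtain ⟨n, hn⟩ := pow_unbounded_of_one_lt x (show (1:ℝ) < 2 by norm_num)
  refine key n x hx (hn.le.trans ?_)
  have : (0:ℝ) < 2 ^ n := by positivity
  nlinarith

lemma ceil_bd {z : ℝ} (hz : 0 ≤ z) : Real.exp z ≤ (⌈Real.exp z⌉₊ : ℝ) ∧
    (⌈Real.exp z⌉₊ : ℝ) ≤ 2 * Real.exp z := by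
  have h1 := Nat.ceil_lt_add_one (Real.exp_pos z).le
  have h2 := Real.one_le_exp hz
  exact ⟨Nat.le_ceil _, by linarith⟩

lemma nat_ev {p : ℝ → Prop} (h : ∀ᶠ x in atTop, p x) : ∀ᶠ n : ℕ in atTop, p (n:ℝ) :=
  tendsto_natCast_atTop_atTop.eventually h

lemma abs_upper {f : ℝ → ℝ} (hf : SlowlyVarying f) (hp : ∀ x, 0 < f x) (hm : Monotone f)
    (P : ℕ → ℝ) (hP1 : ∀ n, P n ≤ 1) (c : ℝ) (hc : 0 < c)
    (hU : ∀ᶠ R : ℕ in atTop, ∀ n : ℕ, P n ≤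
      Real.exp (-(c * n / f (2 * Real.log (2 * R)))) + 4 / R) :
    ∃ c₃ c₄ : ℝ, 0 < c₃ ∧ 0 < c₄ ∧ ∀ n : ℕ, 1 ≤ n →
      P n ≤ c₃ * Real.exp (-(c₄ * n / f (c₄ * n))) := by
  obtain ⟨R0, hR0⟩ := eventually_atTop.1 hU
  obtain ⟨C, hC, hCs⟩ := kap_sqrt hf hp hm
  set K : ℝ := 4 + 2 / f 0 with hK
  have hf0 := hp 0
  have hKp : 0 < K := by positivity
  set c' := min (c / 2) 1 with hc'
  have hc'p : 0 < c' := lt_min (by linarith) one_pos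
  have hsq : ∀ᶠ x : ℝ in atTop, (C * R0) ^ 2 ≤ x := eventually_ge_atTop _
  obtain ⟨N, hN⟩ := eventually_atTop.1 ((nat_ev hCs).and ((nat_ev hsq).and
    ((nat_ev (sv_le hf (fun x _ => hp x) hKp (show (1:ℝ) < 2 by norm_num))).and
    (nat_ev (sv_ge hf (fun x _ => hp x) (c := c' / 2) (by linarith))))))
  refine ⟨max 5 (Real.exp (c' / 2 * N / f 0)), c' / 2, by positivity, by linarith, ?_⟩
  intro n hn1
  have hnp : (1:ℝ) ≤ n := by exact_mod_cast hn1
  by_cases hnN : N ≤ n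
  · obtain ⟨h1, h2, h3, h4⟩ := hN n hnN
    have hfn := hp (n:ℝ)
    set y : ℝ := n / f n with hy
    have hy0 : 0 < y := by positivity
    have hyR : (R0 : ℝ) ≤ y := by
      rw [hy, le_div_iff₀ hfn]
      have hs : C * R0 ≤ √n := Real.le_sqrt_of_sq_le h2
      calc (R0:ℝ) * f n ≤ R0 * (C * √n) := by gcongr
        _ = (C * R0) * √n := by ring
        _ ≤ √n * √n := by gcongr
        _ = n := Real.mul_self_sqrt (by positivity)
    obtain ⟨r1, r2⟩ := ceil_bd hy0.le
    set R := ⌈Real.exp y⌉₊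
    have hRR : R0 ≤ R := by
      have : (R0:ℝ) ≤ R := by
        have := Real.add_one_le_exp y
        linarith
      exact_mod_cast this
    have hRp : (0:ℝ) < R := (Real.exp_pos y).trans_le r1
    have hU' := hR0 R hRR n
    have hlog : 2 * Real.log (2 * R) ≤ K * n := by
      have a1 : Real.log (2 * R) ≤ 2 + y := by
        rw [Real.log_le_iff_le_exp (by positivity), Real.exp_add]
        have : (4:ℝ) ≤ Real.exp 2 := by
          have := Real.add_one_le_exp (1:ℝ)
          have e : Real.exp 2 = Real.exp 1 * Real.exp 1 := by rw [← Real.exp_add]; norm_num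
          rw [e]; nlinarith
        nlinarith [Real.exp_pos y]
      have a2 : y ≤ n / f 0 := by
        rw [hy]; gcongr; exact hm (by positivity)
      have : K * n = 4 * n + 2 * (n / f 0) := by rw [hK]; ring
      rw [this]; linarith
    have hfl : f (2 * Real.log (2 * R)) ≤ 2 * f n := (hm hlog).trans h3
    have b1 : Real.exp (-(c * n / f (2 * Real.log (2 * R)))) ≤ Real.exp (-(c' * y)) := by
      apply Real.exp_le_exp.2
      apply neg_le_neg
      calc c' * y ≤ (c / 2) * y := by gcongr; exact min_le_left _ _
        _ = c * n / (2 * f n) := by rw [hy]; field_simp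
        _ ≤ _ := by gcongr; exact hp _
    have b2 : 4 / (R:ℝ) ≤ 4 * Real.exp (-(c' * y)) := by
      rw [Real.exp_neg, ← div_eq_mul_inv]
      have : Real.exp (c' * y) ≤ R := by
        refine le_trans (Real.exp_le_exp.2 ?_) r1
        have : c' ≤ 1 := min_le_right _ _
        nlinarith
      gcongr
    have b3 : Real.exp (-(c' * y)) ≤ Real.exp (-(c' / 2 * n / f (c' / 2 * n))) := by
      apply Real.exp_le_exp.2
      apply neg_le_neg
      have hq := hp (c' / 2 * n)
      rw [hy, div_le_iff₀ hq]
      have : c' * (n / f n) * f (c' / 2 * n) = c' / 2 * n * (2 * f (c' / 2 * n) / f n) := by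
        field_simp
      rw [this]
      have : 1 ≤ 2 * f (c' / 2 * n) / f n := by rwa [le_div_iff₀ hfn, one_mul]
      have h0 : 0 ≤ c' / 2 * n := by positivity
      nlinarith
    calc P n ≤ 5 * Real.exp (-(c' * y)) := by linarith
      _ ≤ 5 * Real.exp (-(c' / 2 * n / f (c' / 2 * n))) := by linarith
      _ ≤ _ := by gcongr; exact le_max_left _ _
  · push Not at hnN
    have hnN' : (n:ℝ) ≤ N := by exact_mod_cast hnN.le
    calc P n ≤ 1 := hP1 n
      _ = Real.exp (c' / 2 * N / f 0) * Real.exp (-(c' / 2 * N / f 0)) := by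
        rw [← Real.exp_add]; simp
      _ ≤ Real.exp (c' / 2 * N / f 0) * Real.exp (-(c' / 2 * n / f (c' / 2 * n))) := by
        gcongr
        exact hm (by positivity)
      _ ≤ _ := by gcongr; exact le_max_right _ _

lemma kap_key {f : ℝ → ℝ} (hp : ∀ x, 0 < f x) (hm : StrictMono f) (ht : Tendsto f atTop atTop)
    (g : ℝ → ℝ) (hinv : ∀ᶠ u in atTop, f (g u) = u) (c₃ c₄ : ℝ) (h3 : 0 < c₃) (h4 : 0 < c₄)
    (h : ∀ᶠ u in atTop, u * g u ≤ c₃ * g (c₄ * u)) :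
    ∀ᶠ x in atTop, f x / c₄ ≤ f (c₃ * c₄ * (x / f x)) := by
  have t1 : Tendsto (fun x => f x / c₄) atTop atTop := ht.atTop_div_const h4
  filter_upwards [t1.eventually h, t1.eventually hinv, ht.eventually hinv] with x e1 e2 e3
  have e4 : g (f x) = x := hm.injective e3
  rw [mul_div_cancel₀ _ h4.ne', e4] at e1
  have hfx := hp x
  have e5 : g (f x / c₄) ≤ c₃ * c₄ * (x / f x) := by
    have : c₃ * c₄ * (x / f x) = (c₃ * x) / (f x / c₄) := by field_simp
    rw [this, le_div_iff₀ (by positivity)]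
    linarith
  calc f x / c₄ = f (g (f x / c₄)) := e2.symm
    _ ≤ _ := hm.monotone e5

lemma abs_lower {f : ℝ → ℝ} (hf : SlowlyVarying f) (hp : ∀ x, 0 < f x) (hm : StrictMono f)
    (ht : Tendsto f atTop atTop)
    (g : ℝ → ℝ) (hinv : ∀ᶠ u in atTop, f (g u) = u) (c₃ c₄ : ℝ) (h3 : 0 < c₃) (h4 : 0 < c₄)
    (h : ∀ᶠ u in atTop, u * g u ≤ c₃ * g (c₄ * u))
    (P : ℕ → ℝ) (d : ℝ) (hd : 0 < d) (hd1 : d ≤ 1) (hP1 : ∀ n, d ^ n ≤ P n)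
    (A c0 : ℝ) (hA : 0 < A) (hc0 : 0 < c0) (D : ℕ)
    (hL : ∀ R n : ℕ, 1 ≤ R → A / f (2 * Real.log R) ≤ 1 / 2 →
      c0 * Real.exp (-(2 * (A / f (2 * Real.log R)) * n)) ≤ ((R:ℝ) * n + 1) ^ D * P n) :
    ∃ c₁ c₂ : ℝ, 0 < c₁ ∧ 0 < c₂ ∧ ∀ n : ℕ, 1 ≤ n →
      c₁ * Real.exp (-(c₂ * n / f (c₂ * n))) ≤ P n := by
  obtain ⟨C, hC, hCs⟩ := kap_sqrt hf hp hm.monotone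
  set C5 := c₃ * c₄ with hC5
  have hC5p : 0 < C5 := by positivity
  set E : ℝ := 2 * (A * c₄) + D * (2 * C + C5) with hE
  have hEp : 0 < E := by positivity
  obtain ⟨N, hN⟩ := eventually_atTop.1 ((nat_ev hCs).and
    ((nat_ev (kap_key hp hm ht g hinv c₃ c₄ h3 h4 h)).and
    ((nat_ev (sv_le hf (fun x _ => hp x) (c := 2 * E) (by positivity)
      (show (1:ℝ) < 2 by norm_num))).and
    (nat_ev (ht.eventually (eventually_ge_atTop (2 * (A * c₄))))))))
  set c1 := c0 * Real.exp (-(2 * D)) with hc1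
  refine ⟨min c1 (d ^ N), 2 * E, by positivity, by positivity, ?_⟩
  intro n hn1
  have hnp : (1:ℝ) ≤ n := by exact_mod_cast hn1
  by_cases hnN : N ≤ n
  · obtain ⟨s1, s2, s3, s4⟩ := hN n hnN
    have hfn := hp (n:ℝ)
    set y : ℝ := n / f n with hy
    have hy0 : 0 < y := by positivity
    have hsy : √n ≤ C * y := by
      rw [hy, ← mul_div_assoc, le_div_iff₀ hfn]
      calc √n * f n ≤ √n * (C * √n) := by gcongr
        _ = C * (√n * √n) := by ring
        _ = C * n := by rw [Real.mul_self_sqrt (by positivity)]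
    obtain ⟨r1, r2⟩ := ceil_bd (z := C5 * y) (by positivity)
    set R := ⌈Real.exp (C5 * y)⌉₊
    have hRp : (0:ℝ) < R := (Real.exp_pos _).trans_le r1
    have hR1 : 1 ≤ R := by exact_mod_cast hRp
    have hR1' : (1:ℝ) ≤ R := by exact_mod_cast hR1
    have hlog : C5 * y ≤ 2 * Real.log R := by
      have : C5 * y ≤ Real.log R := (Real.le_log_iff_exp_le hRp).2 r1
      have := Real.log_nonneg hR1'
      linarith
    have hfl : f n / c₄ ≤ f (2 * Real.log R) := s2.trans (hm.monotone hlog)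
    have hh : A / f (2 * Real.log R) ≤ A * c₄ / f n := by
      calc A / f (2 * Real.log R) ≤ A / (f n / c₄) := by gcongr
        _ = _ := by field_simp
    have hh2 : A * c₄ / f n ≤ 1 / 2 := by
      rw [div_le_div_iff₀ hfn (by norm_num)]; linarith
    have hL' := hL R n hR1 (hh.trans hh2)
    have b1 : Real.exp (-(2 * (A * c₄) * y)) ≤
        Real.exp (-(2 * (A / f (2 * Real.log R)) * n)) := by
      apply Real.exp_le_exp.2
      apply neg_le_neg
      calc 2 * (A / f (2 * Real.log R)) * n ≤ 2 * (A * c₄ / f n) * n := by gcongr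
        _ = _ := by rw [hy]; field_simp
    have b2 : (R:ℝ) * n + 1 ≤ Real.exp (2 + (2 * C + C5) * y) := by
      have e2 : (4:ℝ) ≤ Real.exp 2 := by
        have := Real.add_one_le_exp (1:ℝ)
        have e : Real.exp 2 = Real.exp 1 * Real.exp 1 := by rw [← Real.exp_add]; norm_num
        rw [e]; nlinarith
      have en : (n:ℝ) ≤ Real.exp (2 * C * y) := by
        have t := Real.add_one_le_exp (√n)
        have t0 : 0 ≤ √(n:ℝ) := Real.sqrt_nonneg _
        calc (n:ℝ) = √n * √n := (Real.mul_self_sqrt (by positivity)).symm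
          _ ≤ Real.exp √n * Real.exp √n := by gcongr <;> linarith
          _ = Real.exp (2 * √n) := by rw [← Real.exp_add]; ring_nf
          _ ≤ _ := Real.exp_le_exp.2 (by linarith)
      have : (1:ℝ) ≤ R * n := by nlinarith
      calc (R:ℝ) * n + 1 ≤ 2 * (R * n) := by linarith
        _ ≤ 2 * ((2 * Real.exp (C5 * y)) * n) := by gcongr
        _ = 4 * (n * Real.exp (C5 * y)) := by ring
        _ ≤ Real.exp 2 * (Real.exp (2 * C * y) * Real.exp (C5 * y)) := by gcongr
        _ = _ := by rw [← Real.exp_add, ← Real.exp_add]; ring_nf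
    have b3 : ((R:ℝ) * n + 1) ^ D ≤ Real.exp (2 * D + D * (2 * C + C5) * y) := by
      calc ((R:ℝ) * n + 1) ^ D ≤ Real.exp (2 + (2 * C + C5) * y) ^ D := by gcongr
        _ = _ := by rw [← Real.exp_nat_mul]; ring_nf
    have hPn : 0 ≤ P n := le_trans (by positivity) (hP1 n)
    have b4 : c1 * Real.exp (-(E * y)) ≤ P n := by
      have q : c0 * Real.exp (-(2 * (A * c₄) * y)) ≤
          Real.exp (2 * D + D * (2 * C + C5) * y) * P n := by
        calc _ ≤ c0 * Real.exp (-(2 * (A / f (2 * Real.log R)) * n)) := by gcongr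
          _ ≤ _ := hL'
          _ ≤ _ := by gcongr
      have q2 : c1 * Real.exp (-(E * y)) = Real.exp (-(2 * D + D * (2 * C + C5) * y)) *
          (c0 * Real.exp (-(2 * (A * c₄) * y))) := by
        rw [hc1, mul_left_comm, mul_assoc, ← Real.exp_add, ← Real.exp_add, hE]; ring_nf
      rw [q2]
      calc _ ≤ Real.exp (-(2 * D + D * (2 * C + C5) * y)) *
            (Real.exp (2 * D + D * (2 * C + C5) * y) * P n) := by gcongr
        _ = P n := by rw [← mul_assoc, ← Real.exp_add]; simp
    refine le_trans ?_ b4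
    have b5 : Real.exp (-(2 * E * n / f (2 * E * n))) ≤ Real.exp (-(E * y)) := by
      apply Real.exp_le_exp.2
      apply neg_le_neg
      have hq := hp (2 * E * n)
      calc E * y = 2 * E * n / (2 * f n) := by rw [hy]; field_simp
        _ ≤ _ := by gcongr
    calc _ ≤ c1 * Real.exp (-(2 * E * n / f (2 * E * n))) := by gcongr; exact min_le_left _ _
      _ ≤ _ := by gcongr
  · push Not at hnN
    have hq := hp (2 * E * n)
    calc _ ≤ d ^ N * 1 := by
          gcongr
          · exact min_le_right _ _
          · exact Real.exp_le_one_iff.2 (neg_nonpos.2 (by positivity))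
      _ ≤ d ^ n := by rw [mul_one]; exact pow_le_pow_of_le_one hd.le hd1 hnN.le
      _ ≤ P n := hP1 n

end AbsD

section WtD

open scoped Pointwise

def TT (l : ℝ → ℝ) (R : ℕ) : ℝ := ∑' j : ℕ, ff l (R + j)

def ZZ (l : ℝ → ℝ) : ℝ := ff l 0 + 2 * TT l 1

def ww (l : ℝ → ℝ) (m : ℤ) : ℝ := (ZZ l)⁻¹ * ff l m.natAbs

lemma TT_hasSum {l : ℝ → ℝ} (hs : Summable (ff l)) (R : ℕ) :
    HasSum (fun j : ℕ => ff l (R + j)) (TT l R) := by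
  have : Summable (fun j : ℕ => ff l (R + j)) := by
    have := (summable_nat_add_iff R).2 hs
    simpa [add_comm] using this
  exact this.hasSum

lemma TT_split {l : ℝ → ℝ} (hs : Summable (ff l)) (R m : ℕ) :
    TT l R = ∑ j ∈ Finset.range m, ff l (R + j) + TT l (R + m) := by
  have h := (TT_hasSum hs R).summable.sum_add_tsum_nat_add m
  unfold TT
  rw [← h]
  congr 2
  ext j
  congr 1; omega

lemma TT_pos {l : ℝ → ℝ} (hp : ∀ x, 0 ≤ x → 0 < l x) (hs : Summable (ff l)) (R : ℕ) :
    0 < TT l R :=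
  (TT_hasSum hs R).summable.tsum_pos (fun j => (ff_pos hp _).le) 0 (ff_pos hp _)

lemma ZZ_pos {l : ℝ → ℝ} (hp : ∀ x, 0 ≤ x → 0 < l x) (hs : Summable (ff l)) : 0 < ZZ l := by
  have := TT_pos hp hs 1
  have := ff_pos hp 0
  unfold ZZ; linarith

lemma natAbs_aux (n : ℕ) : (-((n:ℤ) + 1)).natAbs = 1 + n := by
  rw [Int.natAbs_neg]; omega

lemma ZZ_eq {l : ℝ → ℝ} (hs : Summable (ff l)) : TT l 0 + TT l 1 = ZZ l := by
  have h := TT_split hs 0 1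
  rw [Finset.sum_range_one] at h
  unfold ZZ
  rw [h, zero_add, zero_add]; ring

lemma ZZ_hasSum {l : ℝ → ℝ} (hs : Summable (ff l)) :
    HasSum (fun m : ℤ => ff l m.natAbs) (ZZ l) := by
  rw [← ZZ_eq hs]
  refine HasSum.of_nat_of_neg_add_one ?_ ?_
  · have h := TT_hasSum hs 0
    simp only [zero_add] at h
    simp only [Int.natAbs_natCast]
    exact h
  · simp only [natAbs_aux]
    exact TT_hasSum hs 1

lemma ww_hasSum {l : ℝ → ℝ} (hp : ∀ x, 0 ≤ x → 0 < l x) (hs : Summable (ff l)) :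
    HasSum (ww l) 1 := by
  have := (ZZ_hasSum hs).mul_left (ZZ l)⁻¹
  rwa [inv_mul_cancel₀ (ZZ_pos hp hs).ne'] at this

lemma ww_pos {l : ℝ → ℝ} (hp : ∀ x, 0 ≤ x → 0 < l x) (hs : Summable (ff l)) (m : ℤ) :
    0 < ww l m := mul_pos (inv_pos.2 (ZZ_pos hp hs)) (ff_pos hp _)

lemma ww_symm (l : ℝ → ℝ) (m : ℤ) : ww l (-m) = ww l m := by
  unfold ww; rw [Int.natAbs_neg]

lemma ff_natAbs (l : ℝ → ℝ) (m : ℤ) :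
    ff l m.natAbs = 1 / ((1 + |(m:ℝ)|) * l (1 + |(m:ℝ)| ^ 2)) := by
  unfold ff
  rw [Nat.cast_natAbs, Int.cast_abs]

lemma ww_eq {l : ℝ → ℝ} (hs : Summable (ff l)) :
    (fun m : ℤ => (∑' m' : ℤ, 1 / ((1 + (|m'| : ℝ)) * l (1 + (|m'| : ℝ) ^ 2)))⁻¹ /
      ((1 + (|m| : ℝ)) * l (1 + (|m| : ℝ) ^ 2))) = ww l := by
  have h := (ZZ_hasSum hs).tsum_eq
  simp only [ff_natAbs] at h
  funext m
  rw [h]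
  unfold ww
  rw [ff_natAbs, mul_one_div]

lemma ww_Icc {l : ℝ → ℝ} (hp : ∀ x, 0 ≤ x → 0 < l x) (hs : Summable (ff l)) (R : ℕ) :
    ∑ m ∈ Finset.Icc (-(R:ℤ)) R, ww l m = 1 - 2 * (ZZ l)⁻¹ * TT l (R + 1) := by
  have h : ∀ R : ℕ, ∑ m ∈ Finset.Icc (-(R:ℤ)) R, ff l m.natAbs =
      ff l 0 + 2 * ∑ j ∈ Finset.range R, ff l (1 + j) := by
    intro R
    induction R with
    | zero => simp
    | succ R ih =>
      have e : Finset.Icc (-((R+1 : ℕ):ℤ)) ((R+1 : ℕ):ℤ) =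
          insert (-((R+1 : ℕ):ℤ)) (insert ((R+1 : ℕ):ℤ) (Finset.Icc (-(R:ℤ)) R)) := by
        ext x; simp only [Finset.mem_insert, Finset.mem_Icc]; omega
      rw [e, Finset.sum_insert, Finset.sum_insert, ih, Finset.sum_range_succ,
        Int.natAbs_neg, Int.natAbs_natCast, add_comm R 1]
      · ring
      · simp only [Finset.mem_Icc]; omega
      · simp only [Finset.mem_insert, Finset.mem_Icc]; omega
  unfold ww
  rw [← Finset.mul_sum, h R]
  have hz := ZZ_pos hp hs
  have e : ff l 0 + 2 * ∑ j ∈ Finset.range R, ff l (1 + j) = ZZ l - 2 * TT l (R + 1) := by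
    unfold ZZ; rw [TT_split hs 1 R, add_comm 1 R]; ring
  rw [e]; field_simp

lemma ww_ge {l : ℝ → ℝ} (hs : Summable (ff l)) (R : ℕ) :
    HasSum (fun m : ℤ => if (R:ℤ) ≤ m then ww l m else 0) ((ZZ l)⁻¹ * TT l R) := by
  have hinj : Function.Injective (fun j : ℕ => (((R + j : ℕ)) : ℤ)) := by
    intro a b h; simp at h; exact h
  rw [← hinj.hasSum_iff]
  · have e : ((fun m : ℤ => if (R:ℤ) ≤ m then ww l m else 0) ∘
        fun j : ℕ => (((R + j : ℕ)) : ℤ)) = fun j : ℕ => (ZZ l)⁻¹ * ff l (R + j) := by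
      funext j
      have h1 : (R:ℤ) ≤ ((R + j : ℕ) : ℤ) := by omega
      simp only [Function.comp, if_pos h1, ww, Int.natAbs_natCast]
    rw [e]
    exact (TT_hasSum hs R).mul_left _
  · intro x hx
    rw [if_neg]
    intro h
    exact hx ⟨(x - R).toNat, by simp; omega⟩

lemma ff_ratio {l : ℝ → ℝ} (hp : ∀ x, 0 ≤ x → 0 < l x) (hm : MonotoneOn l (Set.Ici 0))
    (hsv : SlowlyVarying l) (hs : Summable (ff l)) :
    ∀ᶠ R : ℕ in atTop, ff l R / TT l R ≤ 4 / R := by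
  have h := sv_le hsv hp (c := 4) (a := 2) (by norm_num) (by norm_num)
  have ht : Tendsto (fun R : ℕ => 1 + (R:ℝ) ^ 2) atTop atTop :=
    tendsto_atTop_add_const_left _ _
      ((tendsto_pow_atTop two_ne_zero).comp tendsto_natCast_atTop_atTop)
  filter_upwards [ht.eventually h, eventually_ge_atTop 1] with R h1 h2
  have hR : (1:ℝ) ≤ R := by exact_mod_cast h2
  have hT : R * ff l (2 * R) ≤ TT l R := by
    rw [TT_split hs R R]
    have : R * ff l (2 * R) ≤ ∑ j ∈ Finset.range R, ff l (R + j) := by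
      have := Finset.card_nsmul_le_sum (Finset.range R) (fun j => ff l (R + j)) (ff l (2 * R))
        (fun j hj => ff_anti hp hm (by have := Finset.mem_range.1 hj; omega))
      simpa using this
    have := TT_pos hp hs (R + R)
    linarith
  have l0 := hp (1 + (R:ℝ) ^ 2) (by positivity)
  have l1 : l (1 + ((2 * R : ℕ):ℝ) ^ 2) ≤ 2 * l (1 + (R:ℝ) ^ 2) := by
    refine le_trans (hm ?_ ?_ ?_) h1
    · rw [Set.mem_Ici]; positivity
    · rw [Set.mem_Ici]; positivity
    · push_cast; nlinarith
  have l2 := hp (1 + ((2 * R : ℕ):ℝ) ^ 2) (by positivity)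
  have hf2 := ff_pos hp (2 * R)
  have key : ff l R ≤ 4 * ff l (2 * R) := by
    unfold ff
    rw [mul_one_div, div_le_div_iff₀ (by positivity) (by positivity), one_mul]
    calc (1 + ((2 * R : ℕ):ℝ)) * l (1 + ((2 * R : ℕ):ℝ) ^ 2)
        ≤ (2 * (1 + (R:ℝ))) * (2 * l (1 + (R:ℝ) ^ 2)) := by
          gcongr; push_cast; linarith
      _ = _ := by ring
  rw [div_le_div_iff₀ (TT_pos hp hs R) (by positivity)]
  calc ff l R * R ≤ (4 * ff l (2 * R)) * R := by gcongr
    _ = 4 * (R * ff l (2 * R)) := by ring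
    _ ≤ _ := by gcongr

lemma exp_log_sq {x : ℝ} (hx : 0 < x) : Real.exp (-(2 * Real.log x)) = 1 / x ^ 2 := by
  rw [Real.exp_neg, two_mul, Real.exp_add, Real.exp_log hx, one_div, sq]

lemma kap_pos {l : ℝ → ℝ} (hl : ContinuousOn l (Set.Ici 0)) (hp : ∀ x, 0 ≤ x → 0 < l x)
    (hm : MonotoneOn l (Set.Ici 0))
    (hi : IntegrableOn (fun t => 1 / (t * l (1 / t))) (Set.Ioc 0 1)) (u : ℝ) :
    0 < thetaOf l (Real.exp u) := by
  rw [theta_eq]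
  exact one_div_pos.2 (If_pos hl hp hm hi (Real.exp_pos _))

lemma kap_mono {l : ℝ → ℝ} (hl : ContinuousOn l (Set.Ici 0)) (hp : ∀ x, 0 ≤ x → 0 < l x)
    (hm : MonotoneOn l (Set.Ici 0))
    (hi : IntegrableOn (fun t => 1 / (t * l (1 / t))) (Set.Ioc 0 1)) :
    StrictMono fun u => thetaOf l (Real.exp u) := by
  intro a b hab
  simp only [theta_eq]
  apply one_div_lt_one_div_of_lt (If_pos hl hp hm hi (Real.exp_pos _))
  exact If_strict hl hp hm hi (Real.exp_pos _) (Real.exp_lt_exp.2 (by linarith))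

lemma kap_tendsto {l : ℝ → ℝ} (hl : ContinuousOn l (Set.Ici 0)) (hp : ∀ x, 0 ≤ x → 0 < l x)
    (hm : MonotoneOn l (Set.Ici 0))
    (hi : IntegrableOn (fun t => 1 / (t * l (1 / t))) (Set.Ioc 0 1)) :
    Tendsto (fun u => thetaOf l (Real.exp u)) atTop atTop := by
  simp only [theta_eq, one_div]
  apply Tendsto.inv_tendsto_nhdsGT_zero
  have h1 : Tendsto (fun u : ℝ => Real.exp (-u)) atTop (𝓝[>] 0) :=
    tendsto_nhdsWithin_iff.2 ⟨Real.tendsto_exp_neg_atTop_nhds_zero,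
      Eventually.of_forall fun u => Real.exp_pos _⟩
  exact tendsto_nhdsWithin_iff.2 ⟨(If_tendsto hi).comp h1,
      Eventually.of_forall fun u => If_pos hl hp hm hi (Real.exp_pos _)⟩

lemma conc_upper {G : Type*} [Group G] {k : ℕ} (hk : 0 < k)
    (s : Fin k → G) (htor : ∃ i, ∀ m : ℤ, m ≠ 0 → s i ^ m ≠ 1) {l : ℝ → ℝ}
    (hl : ContinuousOn l (Set.Ici 0)) (hp : ∀ x, 0 ≤ x → 0 < l x)
    (hm : MonotoneOn l (Set.Ici 0)) (hsv : SlowlyVarying l)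
    (hi : IntegrableOn (fun t => 1 / (t * l (1 / t))) (Set.Ioc 0 1)) :
    ∀ᶠ R : ℕ in atTop, ∀ n : ℕ, convPow (genMeasure s (ww l)) n 1 ≤
      Real.exp (-((ZZ l)⁻¹ / (6 * k) * n / thetaOf l (Real.exp (2 * Real.log (2 * R))))) + 4 / R := by
  have hs := ff_summable hl hp hm hi
  have hz := ZZ_pos hp hs
  obtain ⟨i, hti⟩ := htor
  have hk1 : (1:ℝ) ≤ k := by exact_mod_cast hk
  filter_upwards [ff_ratio hp hm hsv hs, eventually_ge_atTop 1] with R h1 h2 n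
  have hR : (1:ℝ) ≤ R := by exact_mod_cast h2
  have hT := TT_pos hp hs R
  have hw := ww_pos hp hs
  set h := (ZZ l)⁻¹ * TT l R with hh
  have hhp : 0 < h := by positivity
  have hg := ww_ge hs R
  have hle : h ≤ 1 := hasSum_le (fun m => by
    split_ifs
    · exact le_rfl
    · exact (hw m).le) hg (ww_hasSum hp hs)
  have hup := gen_upper hk s (ww l) (fun m => (hw m).le) (ww_hasSum hp hs) i hti
    (fun m => (R:ℤ) ≤ m) ((ZZ l)⁻¹ * ff l R) (mul_nonneg (by positivity) (ff_pos hp _).le)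
    (fun m hmR => by
      unfold ww
      have : ff l m.natAbs ≤ ff l R := ff_anti hp hm (by omega)
      gcongr) h hhp (by convert hg) n
  refine hup.trans (add_le_add ?_ ?_)
  · have q0 : h / k ≤ 1 := by rw [div_le_one (by linarith)]; linarith
    have q1 : 1 - h / k ≤ Real.exp (-(h / k)) := Real.one_sub_le_exp_neg _
    calc (1 - h / k) ^ n ≤ Real.exp (-(h / k)) ^ n := pow_le_pow_left₀ (by linarith) q1 n
      _ = Real.exp (-(h / k * n)) := by rw [← Real.exp_nat_mul]; ring_nf
      _ ≤ _ := by
        apply Real.exp_le_exp.2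
        apply neg_le_neg
        rw [theta_eq, exp_log_sq (by linarith), div_div_eq_mul_div, div_one]
        have := le_ff_tail hl hp hm hi R h2
        change _ ≤ 6 * TT l R at this
        calc (ZZ l)⁻¹ / (6 * k) * n * If l (1 / (2 * (R:ℝ)) ^ 2)
            ≤ (ZZ l)⁻¹ / (6 * k) * n * (6 * TT l R) := by gcongr
          _ = _ := by rw [hh]; field_simp
  · rw [hh, mul_div_mul_left _ _ (by positivity)]
    exact h1

lemma conc_lower {G : Type*} [Group G] [Group.IsNilpotent G] {k : ℕ} (hk : 0 < k)
    (s : Fin k → G) (hgen : Subgroup.closure (Set.range s) = ⊤) {l : ℝ → ℝ}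
    (hl : ContinuousOn l (Set.Ici 0)) (hp : ∀ x, 0 ≤ x → 0 < l x)
    (hm : MonotoneOn l (Set.Ici 0))
    (hi : IntegrableOn (fun t => 1 / (t * l (1 / t))) (Set.Ioc 0 1)) :
    ∃ (c0 : ℝ) (D : ℕ), 0 < c0 ∧ ∀ R n : ℕ, 1 ≤ R →
      2 * (ZZ l)⁻¹ / thetaOf l (Real.exp (2 * Real.log R)) ≤ 1 / 2 →
      c0 * Real.exp (-(2 * (2 * (ZZ l)⁻¹ / thetaOf l (Real.exp (2 * Real.log R))) * n)) ≤
        ((R:ℝ) * n + 1) ^ D * convPow (genMeasure s (ww l)) n 1 := by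
  have hs := ff_summable hl hp hm hi
  have hz := ZZ_pos hp hs
  have hw := ww_pos hp hs
  have hw1 := ww_hasSum hp hs
  obtain ⟨C, D, hCD⟩ := growth_nilpotent s hgen
  have hμ := gen_nonneg s (ww l) (fun m => (hw m).le)
  have hμ1 := gen_hasSum hk s (ww l) hw1
  have hμ0 := gen_one hk s (ww l) (fun m => (hw m).le) hw1
  set d := ww l 0 with hd
  have hdp : 0 < d := hw 0
  have hd1 : d ≤ 1 := le_hasSum hw1 0 fun j _ => (hw j).le
  set P := fun n => convPow (genMeasure s (ww l)) n 1 with hP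
  have hPn : ∀ n, 0 ≤ P n := fun n => convPow_nonneg _ hμ n 1
  refine ⟨d / (C + 1), D, by positivity, ?_⟩
  intro R n hR1 hh
  have hR : (1:ℝ) ≤ R := by exact_mod_cast hR1
  have hkap := kap_pos hl hp hm hi (2 * Real.log R)
  have hT := ff_tail_le hl hp hm hi R hR1
  have hT' : TT l (R + 1) ≤ If l (1 / (R:ℝ) ^ 2) := by
    refine le_of_eq_of_le ?_ hT
    unfold TT; congr 1; ext j; congr 1; omega
  set h := 2 * (ZZ l)⁻¹ / thetaOf l (Real.exp (2 * Real.log R)) with hhd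
  have hh0 : 0 ≤ h := by positivity
  have e : h = 2 * (ZZ l)⁻¹ * If l (1 / (R:ℝ) ^ 2) := by
    rw [hhd, theta_eq, exp_log_sq (by linarith), div_div_eq_mul_div, div_one]
  have hsum : 1 - h ≤ ∑ m ∈ Finset.Icc (-(R:ℤ)) R, ww l m := by
    rw [ww_Icc hp hs, e]
    gcongr
  have hexp : Real.exp (-(2 * h)) ≤ 1 - h := by
    rw [Real.exp_neg]
    have := Real.add_one_le_exp (2 * h)
    rw [inv_le_iff_one_le_mul₀ (Real.exp_pos _)]
    nlinarith
  obtain ⟨F, hF1, hF2⟩ := hCD (R * (n / 2))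
  have hlow := gen_lower hk s (ww l) (fun m => (hw m).le) (ww_symm l) hw1 R (n / 2) F hF1
  have hF3 : (F.card : ℝ) ≤ (C + 1) * ((R:ℝ) * n + 1) ^ D := by
    have a1 : (F.card : ℝ) ≤ C * ((R:ℝ) * ((n / 2 : ℕ) : ℝ) + 1) ^ D := by exact_mod_cast hF2
    have a2 : ((n / 2 : ℕ) : ℝ) ≤ n := by exact_mod_cast Nat.div_le_self n 2
    refine a1.trans ?_
    gcongr
    linarith
  have hstep : d * P (2 * (n / 2)) ≤ P n := by
    rcases Nat.even_or_odd' n with ⟨m, hm | hm⟩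
    · have : 2 * (n / 2) = n := by omega
      rw [this]
      nlinarith [hPn n]
    · have e2 : n = 2 * (n / 2) + 1 := by omega
      have := convPow_mul_le _ hμ hμ1 (2 * (n / 2))
      rw [← e2] at this
      refine le_trans ?_ this
      exact mul_le_mul_of_nonneg_right hμ0 (hPn _)
  have hmain : Real.exp (-(2 * h * n)) ≤ (C + 1) * ((R:ℝ) * n + 1) ^ D * P (2 * (n / 2)) := by
    calc Real.exp (-(2 * h * n)) = Real.exp (-(2 * h)) ^ n := by
          rw [← Real.exp_nat_mul]; ring_nf
      _ ≤ (1 - h) ^ n := pow_le_pow_left₀ (Real.exp_pos _).le hexp n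
      _ ≤ (1 - h) ^ (2 * (n / 2)) := pow_le_pow_of_le_one (by linarith) (by linarith) (by omega)
      _ ≤ (∑ m ∈ Finset.Icc (-(R:ℤ)) R, ww l m) ^ (2 * (n / 2)) :=
          pow_le_pow_left₀ (by linarith) hsum _
      _ ≤ _ := hlow
      _ ≤ _ := mul_le_mul_of_nonneg_right hF3 (hPn _)
  have hX : 0 ≤ ((R:ℝ) * n + 1) ^ D := by positivity
  calc d / (C + 1) * Real.exp (-(2 * h * n))
      ≤ d / (C + 1) * ((C + 1) * ((R:ℝ) * n + 1) ^ D * P (2 * (n / 2))) := by gcongr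
    _ = ((R:ℝ) * n + 1) ^ D * (d * P (2 * (n / 2))) := by field_simp
    _ ≤ _ := mul_le_mul_of_nonneg_left hstep hX

end WtD

/-- return probability of a measure supported on powers of generators of a
nilpotent group, second regime: if `κ = θ∘exp` is slowly varying with
`sκ⁻¹(s) ≃ κ⁻¹(s)`, then `μ^{(n)}(e) ≃ exp(-n/κ(n))`. -/
theorem statement9 {G : Type*} [Group G] [Group.IsNilpotent G] {k : ℕ} (hk : 0 < k)
    (s : Fin k → G) (hgen : Subgroup.closure (Set.range s) = ⊤)
    (htor : ∃ i, ∀ m : ℤ, m ≠ 0 → s i ^ m ≠ 1)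
    (l : ℝ → ℝ) (hlcont : ContinuousOn l (Set.Ici 0))
    (hlpos : ∀ x, 0 ≤ x → 0 < l x) (hlmono : MonotoneOn l (Set.Ici 0))
    (hlsv : SlowlyVarying l)
    (hlint : IntegrableOn (fun t => 1 / (t * l (1 / t))) (Set.Ioc 0 1))
    (hκsv : SlowlyVarying (fun u => thetaOf l (Real.exp u)))
    (κinv : ℝ → ℝ) (hinv : ∀ᶠ u in atTop, thetaOf l (Real.exp (κinv u)) = u)
    (hasymp : ∃ c₁ c₂ c₃ c₄ : ℝ, 0 < c₁ ∧ 0 < c₂ ∧ 0 < c₃ ∧ 0 < c₄ ∧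
      ∀ᶠ u in atTop,
        c₁ * κinv (c₂ * u) ≤ u * κinv u ∧ u * κinv u ≤ c₃ * κinv (c₄ * u)) :
    ∃ c₁ c₂ c₃ c₄ : ℝ, 0 < c₁ ∧ 0 < c₂ ∧ 0 < c₃ ∧ 0 < c₄ ∧
      ∀ n : ℕ, 1 ≤ n →
        c₁ * Real.exp (-(c₂ * n / thetaOf l (Real.exp (c₂ * n)))) ≤
            convPow
              (genMeasure s (fun m =>
                (∑' m' : ℤ, 1 / ((1 + (|m'| : ℝ)) * l (1 + (|m'| : ℝ) ^ 2)))⁻¹ /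
                  ((1 + (|m| : ℝ)) * l (1 + (|m| : ℝ) ^ 2)))) n 1 ∧
          convPow
              (genMeasure s (fun m =>
                (∑' m' : ℤ, 1 / ((1 + (|m'| : ℝ)) * l (1 + (|m'| : ℝ) ^ 2)))⁻¹ /
                  ((1 + (|m| : ℝ)) * l (1 + (|m| : ℝ) ^ 2)))) n 1 ≤
            c₃ * Real.exp (-(c₄ * n / thetaOf l (Real.exp (c₄ * n)))) := by
  have hs := ff_summable hlcont hlpos hlmono hlint
  have hz := ZZ_pos hlpos hs
  rw [ww_eq hs]
  have hw := ww_pos hlpos hs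
  have hw1 := ww_hasSum hlpos hs
  have hμ := gen_nonneg s (ww l) (fun m => (hw m).le)
  have hμ1 := gen_hasSum hk s (ww l) hw1
  have hμ0 := gen_one hk s (ww l) (fun m => (hw m).le) hw1
  have hkp := kap_pos hlcont hlpos hlmono hlint
  have hkm := kap_mono hlcont hlpos hlmono hlint
  have hkt := kap_tendsto hlcont hlpos hlmono hlint
  have hk0 : (0:ℝ) < k := by exact_mod_cast hk
  obtain ⟨_, _, b3, b4, _, _, hb3, hb4, hb⟩ := hasymp
  obtain ⟨c0, D, hc0, hL⟩ := conc_lower hk s hgen hlcont hlpos hlmono hlint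
  have hP1 : ∀ n, ww l 0 ^ n ≤ convPow (genMeasure s (ww l)) n 1 := by
    intro n
    induction n with
    | zero => simp [convPow]
    | succ n ih =>
      refine le_trans ?_ (convPow_mul_le _ hμ hμ1 n)
      rw [pow_succ, mul_comm]
      exact mul_le_mul hμ0 ih (pow_nonneg (hw 0).le n) (hμ 1)
  obtain ⟨c₁, c₂, h1, h2, h12⟩ := abs_lower hκsv hkp hkm hkt κinv hinv b3 b4 hb3 hb4
    (hb.mono fun u hu => hu.2) (fun n => convPow (genMeasure s (ww l)) n 1) (ww l 0) (hw 0)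
    (le_hasSum hw1 0 fun j _ => (hw j).le) hP1 (2 * (ZZ l)⁻¹) c0 (by positivity) hc0 D hL
  obtain ⟨c₃, c₄, h3, h4, h34⟩ := abs_upper hκsv hkp hkm.monotone
    (fun n => convPow (genMeasure s (ww l)) n 1) (fun n => convPow_le_one _ hμ hμ1 n 1)
    ((ZZ l)⁻¹ / (6 * k)) (by positivity) (conc_upper hk s htor hlcont hlpos hlmono hlsv hlint)
  exact ⟨c₁, c₂, c₃, c₄, h1, h2, h3, h4, fun n hn => ⟨h12 n hn, h34 n hn⟩⟩
end
end

section
/- Let ℓ:[0,∞)→[0,∞) be continuous, increasing, slowly varying at infinity, with ∫_0^{1/s} dt/(t ℓ(1/t)) < ∞, and set θ(s) = 1/∫_0^{1/s} dt/(t ℓ(1/t)). Let G be a finitely generated group with word-length |·| and polynomial volume growth of degree D. Let φ be a symmetric probability measure on G with φ(g) ≃ 1/((1+|g|)^D ℓ(1+|g|²)). Then there exists a constant C such that for every g ∈ G and every f ∈ L²(G): Σ_{x∈G} |f(xg) − f(x)|² ≤ C θ(1+|g|²) E_φ(f,f). -/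
open MeasureTheory Filter Topology Set
open scoped Classical BigOperators

noncomputable section

lemma aux_dbl (l : ℝ → ℝ) (hlpos : ∀ x, 0 ≤ x → 0 < l x) (hlmono : MonotoneOn l (Set.Ici 0))
    (hlsv : SlowlyVarying l) (lam : ℝ) (hlam : 0 < lam) :
    ∃ K : ℝ, 0 < K ∧ ∀ x, 1 ≤ x → l (lam * x) ≤ K * l x := by
  have h := (hlsv lam hlam).eventually (gt_mem_nhds (show (1:ℝ) < 2 by norm_num))
  obtain ⟨X, hX⟩ := (h.and (eventually_ge_atTop (1:ℝ))).exists_forall_of_atTop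
  have hX1 : 1 ≤ X := (hX X le_rfl).2
  have hl1 := hlpos 1 (by norm_num)
  have hlX := hlpos (lam * X) (by positivity)
  refine ⟨2 + l (lam * X) / l 1, by positivity, fun x hx => ?_⟩
  have hlx := hlpos x (by linarith)
  have hq : 0 ≤ l (lam * X) / l 1 := by positivity
  rcases le_total X x with hXx | hxX
  · have := (hX x hXx).1
    rw [div_lt_iff₀ hlx] at this
    nlinarith
  · have h1 : l (lam * x) ≤ l (lam * X) :=
      hlmono (show (0:ℝ) ≤ _ by positivity) (show (0:ℝ) ≤ _ by positivity)
        (mul_le_mul_of_nonneg_left hxX hlam.le)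
    have h2 : l 1 ≤ l x := hlmono (show (0:ℝ) ≤ _ by norm_num) (show (0:ℝ) ≤ _ by linarith) hx
    have h3 : l (lam * X) = l (lam * X) / l 1 * l 1 := by field_simp
    nlinarith [mul_le_mul_of_nonneg_left h2 hq]

lemma aux_tail (l : ℝ → ℝ) (hlpos : ∀ x, 0 ≤ x → 0 < l x) (hlmono : MonotoneOn l (Set.Ici 0))
    (hlint : IntegrableOn (fun t => 1 / (t * l (1 / t))) (Set.Ioc 0 1))
    (A : ℕ) (hA : 2 ≤ A) (F m : ℕ → ℝ) (hF : ∀ n, 0 ≤ F n)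
    (hFm : ∀ n, 1 ≤ n → F (A * n) + m n ≤ F n) (K : ℝ) (hK : 0 < K)
    (hm : ∀ n : ℕ, 1 ≤ n → (A:ℝ) ^ 2 / l ((n:ℝ) ^ 2) ≤ K * m n) (n : ℕ) (hn : 1 ≤ n) :
    ∫ t in Set.Ioc (0:ℝ) (1 / (n:ℝ) ^ 2), 1 / (t * l (1 / t)) ≤ K * F n := by
  have hAr : (2:ℝ) ≤ A := by exact_mod_cast hA
  have hsub : ∀ n : ℕ, 1 ≤ n → 1 / (n:ℝ) ^ 2 ≤ 1 := by
    intro n hn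
    have : (1:ℝ) ≤ n := by exact_mod_cast hn
    rw [div_le_one (by positivity)]
    nlinarith
  have hint : ∀ (a : ℝ) (n : ℕ), 0 ≤ a → 1 ≤ n → 
      IntegrableOn (fun t => 1 / (t * l (1 / t))) (Set.Ioc a (1 / (n:ℝ) ^ 2)) := by
    intro a n ha hn
    exact hlint.mono_set (Set.Ioc_subset_Ioc ha (hsub n hn))
  have hstep : ∀ n : ℕ, 1 ≤ n → 
      ∫ t in Set.Ioc (1 / ((A * n : ℕ):ℝ) ^ 2) (1 / (n:ℝ) ^ 2), 1 / (t * l (1 / t)) ≤ K * m n := by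
    intro n hn
    refine le_trans ?_ (hm n hn)
    have hn' : (1:ℝ) ≤ n := by exact_mod_cast hn
    have hln := hlpos ((n:ℝ)^2) (by positivity)
    have hle : 1 / ((A * n : ℕ):ℝ) ^ 2 ≤ 1 / (n:ℝ)^2 := by
      push_cast
      apply one_div_le_one_div_of_le (by positivity)
      gcongr
      nlinarith
    calc _ ≤ ∫ t in Set.Ioc (1 / ((A * n : ℕ):ℝ) ^ 2) (1 / (n:ℝ) ^ 2), 
          ((A:ℝ) * n) ^ 2 / l ((n:ℝ)^2) := by
          apply setIntegral_mono_on (hint _ n (by positivity) hn)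
          · exact (integrableOn_const (by simp))
          · exact measurableSet_Ioc
          · intro t ht
            obtain ⟨h1, h2⟩ := ht
            push_cast at h1
            have ht0 : 0 < t := lt_of_le_of_lt (by positivity) h1
            have h3 : (n:ℝ)^2 ≤ 1 / t := by
              rw [le_div_iff₀ ht0]
              rw [le_div_iff₀ (by positivity)] at h2
              linarith
            have h4 : l ((n:ℝ)^2) ≤ l (1/t) :=
              hlmono (show (0:ℝ) ≤ _ by positivity) (show (0:ℝ) ≤ _ by positivity) h3
            have h5 : 1 ≤ ((A:ℝ) * n) ^ 2 * t := by
              rw [div_lt_iff₀ (by positivity)] at h1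
              linarith
            have h6 := hlpos (1/t) (by positivity)
            rw [div_le_div_iff₀ (by positivity) hln]
            nlinarith [mul_le_mul h5 h4 hln.le (by positivity)]
      _ = (1 / (n:ℝ) ^ 2 - 1 / ((A * n : ℕ):ℝ) ^ 2) * (((A:ℝ) * n) ^ 2 / l ((n:ℝ)^2)) := by
          rw [setIntegral_const, Measure.real, Real.volume_Ioc, ENNReal.toReal_ofReal (by linarith)]
          simp
      _ ≤ 1 / (n:ℝ) ^ 2 * (((A:ℝ) * n) ^ 2 / l ((n:ℝ)^2)) := by
          gcongr
          have : 0 ≤ 1 / ((A * n : ℕ):ℝ) ^ 2 := by positivity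
          linarith
      _ = _ := by field_simp
  have hind : ∀ N : ℕ, ∀ n : ℕ, 1 ≤ n → 
      ∫ t in Set.Ioc (1 / ((A ^ N * n : ℕ):ℝ) ^ 2) (1 / (n:ℝ) ^ 2), 1 / (t * l (1 / t)) 
        ≤ K * F n := by
    intro N
    induction N with
    | zero => 
      intro n hn
      simp only [pow_zero, one_mul, Set.Ioc_self, Measure.restrict_empty, integral_zero_measure]
      exact mul_nonneg hK.le (hF n)
    | succ N ih =>
      intro n hn
      have hAn : 1 ≤ A * n := Nat.mul_pos (by omega) hn
      have h1 := ih (A * n) hAn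
      have h2 := hstep n hn
      have h3 := mul_le_mul_of_nonneg_left (hFm n hn) hK.le
      have e : A ^ N * (A * n) = A ^ (N+1) * n := by ring
      rw [e] at h1
      have hn' : (1:ℝ) ≤ n := by exact_mod_cast hn
      have hle : 1 / ((A * n : ℕ):ℝ) ^ 2 ≤ 1 / (n:ℝ)^2 := by
        push_cast
        apply one_div_le_one_div_of_le (by positivity)
        gcongr
        nlinarith
      have hle2 : 1 / ((A ^ (N+1) * n : ℕ):ℝ) ^ 2 ≤ 1 / ((A * n : ℕ):ℝ) ^ 2 := by
        apply one_div_le_one_div_of_le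
        · have : (1:ℝ) ≤ ((A * n : ℕ):ℝ) := by exact_mod_cast hAn
          positivity
        have : A * n ≤ A ^ (N+1) * n := by
          gcongr
          exact Nat.le_self_pow (by omega) A
        gcongr
      rw [← Set.Ioc_union_Ioc_eq_Ioc hle2 hle, setIntegral_union
        (by rw [Set.disjoint_left]; rintro x ⟨_, hx⟩ ⟨hx', _⟩; linarith) measurableSet_Ioc
        (hint _ _ (by positivity) hAn) (hint _ _ (by positivity) hn)]
      linarith
  have hU : (⋃ N : ℕ, Set.Ioc (1 / ((A ^ N * n : ℕ):ℝ) ^ 2) (1 / (n:ℝ) ^ 2)) 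
      = Set.Ioc 0 (1 / (n:ℝ) ^ 2) := by
    ext t
    simp only [Set.mem_iUnion, Set.mem_Ioc]
    constructor
    · rintro ⟨N, h1, h2⟩
      exact ⟨lt_of_le_of_lt (by positivity) h1, h2⟩
    · rintro ⟨h1, h2⟩
      obtain ⟨N, hN⟩ := pow_unbounded_of_one_lt (1/t) (show (1:ℝ) < A by linarith)
      refine ⟨N, ?_, h2⟩
      have hn' : (1:ℝ) ≤ n := by exact_mod_cast hn
      have hp : (1:ℝ) ≤ (A:ℝ)^N := one_le_pow₀ (by linarith)
      push_cast
      rw [div_lt_iff₀ (by positivity)]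
      rw [div_lt_iff₀ h1] at hN
      have hpn : (A:ℝ)^N ≤ (A:ℝ)^N * n := le_mul_of_one_le_right (by positivity) hn'
      have : (A:ℝ)^N ≤ ((A:ℝ)^N * n)^2 := hpn.trans (le_self_pow₀ (hp.trans hpn) (by norm_num))
      nlinarith
  have hmono : Monotone (fun N : ℕ => Set.Ioc (1 / ((A ^ N * n : ℕ):ℝ) ^ 2) (1 / (n:ℝ) ^ 2)) := by
    intro N M hNM
    apply Set.Ioc_subset_Ioc_left
    apply one_div_le_one_div_of_le
    · have : 0 < A ^ N * n := Nat.mul_pos (pow_pos (by omega) _) hn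
      have : (0:ℝ) < ((A ^ N * n : ℕ):ℝ) := by exact_mod_cast this
      positivity
    · have : A ^ N * n ≤ A ^ M * n := by
        gcongr
        omega
      gcongr
  have hT := tendsto_setIntegral_of_monotone (μ := volume) (f := fun t => 1 / (t * l (1 / t)))
    (fun N => measurableSet_Ioc) hmono (by rw [hU]; exact hint 0 n le_rfl hn)
  rw [hU] at hT
  exact le_of_tendsto' hT (fun N => hind N n hn)

lemma aux_word {G : Type*} [Group G] (S : Set G) (hS : IsSymmGen S) (g : G) :
    ∃ w : List G, (∀ x ∈ w, x ∈ S) ∧ w.length = wordLen S g ∧ w.prod = g := by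
  have : {n | ∃ w : List G, (∀ x ∈ w, x ∈ S) ∧ w.length = n ∧ w.prod = g}.Nonempty := by
    have hg : g ∈ Subgroup.closure S := by rw [hS.2.2]; trivial
    rw [← Subgroup.mem_toSubmonoid, Subgroup.closure_toSubmonoid] at hg
    obtain ⟨w, hw, hp⟩ := Submonoid.exists_list_of_mem_closure hg
    refine ⟨w.length, w, fun x hx => ?_, rfl, hp⟩
    rcases hw x hx with h | h
    · exact h
    · have := hS.2.1 _ h
      simpa using this
  exact Nat.sInf_mem this

lemma aux_len {G : Type*} [Group G] (S : Set G) (hS : IsSymmGen S) (g h : G) :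
    wordLen S (g⁻¹ * h) ≤ wordLen S g + wordLen S h := by
  obtain ⟨w, hw, hl, hp⟩ := aux_word S hS g
  obtain ⟨v, hv, hl', hp'⟩ := aux_word S hS h
  refine Nat.sInf_le ⟨(w.map (fun x => x⁻¹)).reverse ++ v, ?_, ?_, ?_⟩
  · intro x hx
    simp only [List.mem_append, List.mem_reverse, List.mem_map] at hx
    rcases hx with ⟨y, hy, rfl⟩ | hx
    · exact hS.2.1 _ (hw y hy)
    · exact hv x hx
  · simp [hl, hl']
  · rw [List.prod_append, ← List.prod_inv_reverse, hp, hp']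

lemma aux_diff {G : Type*} [Group G] (f : G → ℝ) (hf : MemL2 f) (g : G) :
    Summable (fun x => |f (x * g) - f x| ^ 2) ∧
      (∑' x : G, |f (x * g) - f x| ^ 2) ≤ 4 * ∑' x, (f x) ^ 2 := by
  have hf' : Summable (fun x => f (x * g) ^ 2) := (Equiv.mulRight g).summable_iff.mpr hf
  have e : ∑' x, f (x * g) ^ 2 = ∑' x, f x ^ 2 := (Equiv.mulRight g).tsum_eq (fun x => f x ^ 2)
  have hs : Summable (fun x => 2 * f (x * g) ^ 2 + 2 * f x ^ 2) :=
    (hf'.mul_left 2).add (Summable.mul_left 2 hf)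
  have hle : ∀ x, |f (x * g) - f x| ^ 2 ≤ 2 * f (x * g) ^ 2 + 2 * f x ^ 2 := by
    intro x
    rw [sq_abs]
    nlinarith [sq_nonneg (f (x * g) + f x)]
  have h1 := Summable.of_nonneg_of_le (fun x => by positivity) hle hs
  refine ⟨h1, (h1.tsum_le_tsum hle hs).trans ?_⟩
  rw [(hf'.mul_left 2).tsum_add (Summable.mul_left 2 hf), tsum_mul_left, tsum_mul_left, e]
  linarith

lemma aux_tri {G : Type*} [Group G] (f : G → ℝ) (hf : MemL2 f) (g h : G) :
    (∑' x : G, |f (x * g) - f x| ^ 2) ≤ 2 * (∑' x : G, |f (x * h) - f x| ^ 2)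
      + 2 * (∑' x : G, |f (x * (g⁻¹ * h)) - f x| ^ 2) := by
  have h1 := (aux_diff f hf g).1
  have h2 := (aux_diff f hf h).1
  have h3 := (aux_diff f hf (g⁻¹ * h)).1
  have h3' : Summable (fun x : G => |f (Equiv.mulRight g x * (g⁻¹ * h)) - f (Equiv.mulRight g x)| ^ 2) :=
    (Equiv.mulRight g).summable_iff.mpr h3
  have e := (Equiv.mulRight g).tsum_eq (fun x : G => |f (x * (g⁻¹ * h)) - f x| ^ 2)
  rw [← e, ← tsum_mul_left, ← tsum_mul_left, ← (h2.mul_left 2).tsum_add (h3'.mul_left 2)]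
  refine h1.tsum_le_tsum (fun x => ?_) ((h2.mul_left 2).add (h3'.mul_left 2))
  simp only [Equiv.coe_mulRight, mul_assoc, mul_inv_cancel_left, sq_abs]
  nlinarith [sq_nonneg ((f (x * h) - f x) + (f (x * h) - f (x * g)))]

lemma aux_dir {G : Type*} [Group G] (φ : G → ℝ) (hφ : IsSymmProb φ) (f : G → ℝ) (hf : MemL2 f) :
    Summable (fun y => φ y * ∑' x : G, |f (x * y) - f x| ^ 2) ∧
    dirichlet φ f = (1/2) * ∑' y, φ y * ∑' x : G, |f (x * y) - f x| ^ 2 := by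
  have hs : Summable (fun y => φ y * ∑' x : G, |f (x * y) - f x| ^ 2) := by
    refine Summable.of_nonneg_of_le (fun y => mul_nonneg (hφ.1 y) (tsum_nonneg fun x => by positivity))
      (fun y => mul_le_mul_of_nonneg_left (aux_diff f hf y).2 (hφ.1 y)) (hφ.2.1.mul_right _)
  refine ⟨hs, ?_⟩
  have hp : Summable (fun p : G × G => |f (p.2 * p.1) - f p.2| ^ 2 * φ p.1) := by
    have h0 : 0 ≤ (fun p : G × G => |f (p.2 * p.1) - f p.2| ^ 2 * φ p.1) :=
      fun p => mul_nonneg (by positivity) (hφ.1 p.1)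
    refine (summable_prod_of_nonneg h0).mpr ?_
    constructor
    · intro y
      exact (aux_diff f hf y).1.mul_right (φ y)
    refine hs.congr (fun y => ?_)
    dsimp only; rw [tsum_mul_right, mul_comm]
  unfold dirichlet
  congr 1
  rw [← (Equiv.prodComm G G).tsum_eq]
  simp only [Equiv.prodComm_apply, Prod.fst_swap, Prod.snd_swap]
  rw [hp.tsum_prod]
  refine tsum_congr (fun y => ?_)
  dsimp only; rw [tsum_mul_right, mul_comm]

lemma aux_fin {G : Type*} [Group G] (S : Set G) (D : ℕ) (hD : PolyGrowth S D) (n : ℕ) :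
    {g : G | wordLen S g ≤ n}.Finite := by
  obtain ⟨c, C, hc, hC, h⟩ := hD
  have h1 := (h (n+1) (by omega)).1
  have h2 : 0 < vol S (n+1) := by
    have : (0:ℝ) < (vol S (n+1) : ℝ) := lt_of_lt_of_le (by positivity) h1
    exact_mod_cast this
  exact (Set.finite_of_ncard_pos h2).subset (fun g (hg : _ ≤ n) => show _ ≤ n+1 by omega)

lemma aux_I_nonneg (l : ℝ → ℝ) (hlpos : ∀ x, 0 ≤ x → 0 < l x) (a : ℝ) :
    0 ≤ᵐ[volume.restrict (Set.Ioc 0 a)] (fun t => 1 / (t * l (1 / t))) := by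
  refine (ae_restrict_iff' measurableSet_Ioc).mpr (ae_of_all _ fun t ht => ?_)
  have := hlpos (1/t) (by have := ht.1; positivity)
  have := ht.1
  show (0:ℝ) ≤ _
  positivity

lemma aux_lower (l : ℝ → ℝ) (hlpos : ∀ x, 0 ≤ x → 0 < l x) (hlmono : MonotoneOn l (Set.Ici 0))
    (hlsv : SlowlyVarying l)
    (hlint : IntegrableOn (fun t => 1 / (t * l (1 / t))) (Set.Ioc 0 1))
    {G : Type*} [Group G] (S : Set G) (D : ℕ) (hD : PolyGrowth S D)
    (φ : G → ℝ) (hφ : IsSymmProb φ) (c : ℝ) (hc : 0 < c)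
    (hφbound : ∀ g : G,
      c / ((1 + (wordLen S g : ℝ)) ^ D * l (1 + (wordLen S g : ℝ) ^ 2)) ≤ φ g) :
    ∃ K : ℝ, 0 < K ∧ ∀ g : G,
      ∫ t in Set.Ioc (0:ℝ) (1 / (1 + (wordLen S g : ℝ) ^ 2)), 1 / (t * l (1 / t)) ≤
        K * ∑' h, {h | wordLen S g ≤ wordLen S h}.indicator φ h := by
  have hφs : ∀ T : Set G, Summable (T.indicator φ) := fun T => hφ.2.1.indicator T
  have hfin := aux_fin S D hD
  rcases Nat.eq_zero_or_pos D with rfl | hDpos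
  · -- finite group
    have hG : Finite G := by
      obtain ⟨c1, C1, hc1, hC1, h⟩ := hD
      by_contra hinf
      rw [not_finite_iff_infinite] at hinf
      obtain ⟨N, hN⟩ := exists_nat_gt C1
      obtain ⟨s, hs⟩ := Infinite.exists_subset_card_eq G N
      let M := s.sup (wordLen S) + 1
      have h1 : N ≤ vol S M := by
        rw [← hs, ← Set.ncard_coe_finset s]
        refine Set.ncard_le_ncard (fun g hg => ?_) (hfin M)
        have : wordLen S g ≤ s.sup (wordLen S) := Finset.le_sup (f := wordLen S) hg
        show _ ≤ s.sup (wordLen S) + 1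
        omega
      have h2 := (h M (by omega)).2
      have h3 : (N:ℝ) ≤ vol S M := by exact_mod_cast h1
      simp at h2
      linarith
    have hpos : ∀ g, 0 < φ g := fun g => by
      have := hlpos (1 + (wordLen S g : ℝ) ^ 2) (by positivity)
      exact lt_of_lt_of_le (by positivity) (hφbound g)
    obtain ⟨g0, hg0⟩ := Finite.exists_min φ
    set I1 := ∫ t in Set.Ioc (0:ℝ) 1, 1 / (t * l (1 / t)) with hI1
    have hI1n : 0 ≤ I1 := integral_nonneg_of_ae (aux_I_nonneg l hlpos 1)
    refine ⟨(I1 + 1) / φ g0, div_pos (by linarith) (hpos g0), fun g => ?_⟩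
    have h1 : ∫ t in Set.Ioc (0:ℝ) (1 / (1 + (wordLen S g : ℝ) ^ 2)), 1 / (t * l (1 / t)) ≤ I1 := by
      refine setIntegral_mono_set hlint (aux_I_nonneg l hlpos 1) ?_
      refine (Set.Ioc_subset_Ioc_right ?_).eventuallyLE
      rw [div_le_one (by positivity)]
      nlinarith [sq_nonneg (wordLen S g : ℝ)]
    have h2 : φ g0 ≤ ∑' h, {h | wordLen S g ≤ wordLen S h}.indicator φ h := by
      refine (hg0 g).trans ?_
      have := (hφs {h | wordLen S g ≤ wordLen S h}).le_tsum g
        (fun h _ => Set.indicator_nonneg (fun x _ => hφ.1 x) h)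
      rwa [Set.indicator_of_mem (show g ∈ {h | wordLen S g ≤ wordLen S h} from le_refl (wordLen S g))] at this
    calc _ ≤ I1 := h1
      _ ≤ (I1 + 1) / φ g0 * φ g0 := by
        rw [div_mul_cancel₀ _ (hpos g0).ne']; linarith
      _ ≤ _ := mul_le_mul_of_nonneg_left h2 (div_pos (by linarith) (hpos g0)).le
  obtain ⟨c1, C1, hc1, hC1, hV⟩ := hD
  obtain ⟨A0, hA0⟩ := exists_nat_gt ((C1 + 1) / c1)
  set A := A0 + 2 with hAdef
  have hA : C1 + 1 ≤ c1 * (A:ℝ) ^ D := by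
    rw [div_lt_iff₀ hc1] at hA0
    have h1 : (1:ℝ) ≤ A := by rw [hAdef]; push_cast; linarith [(Nat.cast_nonneg A0 : (0:ℝ) ≤ A0)]
    have h2 : (A:ℝ) ≤ (A:ℝ)^D := le_self_pow₀ h1 (by omega)
    have h3 : (A0:ℝ) ≤ A := by rw [hAdef]; push_cast; linarith
    nlinarith
  have hA2 : 2 ≤ A := by omega
  have hAr : (2:ℝ) ≤ A := by exact_mod_cast hA2
  obtain ⟨K1, hK1, hdb⟩ := aux_dbl l hlpos hlmono hlsv (2 * (A:ℝ)^2) (by positivity)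
  let F : ℕ → ℝ := fun n => ∑' h, {h | n < wordLen S h}.indicator φ h
  let q : ℕ → ℝ := fun n => c / ((1 + (A:ℝ) * n) ^ D * l (1 + ((A:ℝ) * n) ^ 2))
  have hq : ∀ n, 0 < q n := fun n => by
    have := hlpos (1 + ((A:ℝ) * n) ^ 2) (by positivity)
    positivity
  let m : ℕ → ℝ := fun n => (n:ℝ)^D * q n
  have hF : ∀ n, 0 ≤ F n := fun n => tsum_nonneg fun h =>
    Set.indicator_nonneg (fun x _ => hφ.1 x) h
  have hFm : ∀ n, 1 ≤ n → F (A * n) + m n ≤ F n := by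
    intro n hn
    have hBfin := hfin (A * n)
    let T : Set G := {h | wordLen S h ≤ A * n} \ {h | wordLen S h ≤ n}
    have hT : T.Finite := hBfin.subset Set.sdiff_subset
    have hcard : (n:ℝ)^D ≤ (T.ncard : ℝ) := by
      have hsub : {h : G | wordLen S h ≤ n} ⊆ {h | wordLen S h ≤ A * n} := by
        intro h (hh : _ ≤ n)
        show _ ≤ A * n
        nlinarith
      have h1 := Set.ncard_sdiff_add_ncard_of_subset hsub hBfin
      have h2 : (T.ncard : ℝ) + (vol S n : ℝ) = (vol S (A * n) : ℝ) := by exact_mod_cast h1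
      have h3 := (hV n hn).2
      have h4 := (hV (A * n) (Nat.mul_pos (by omega) hn)).1
      push_cast at h4
      rw [mul_pow] at h4
      have : (0:ℝ) ≤ (n:ℝ)^D := by positivity
      nlinarith
    have hsT : Summable (T.indicator (fun _ => q n)) := 
      summable_of_hasFiniteSupport (hT.subset Set.support_indicator_subset)
    have hsum : ∑' h, T.indicator (fun _ => q n) h = T.ncard * q n := by
      rw [tsum_eq_sum (s := hT.toFinset) (fun b hb => Set.indicator_of_notMem (by simpa using hb) _)]
      rw [Finset.sum_congr rfl (fun x hx => Set.indicator_of_mem (by simpa using hx) _)]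
      rw [Finset.sum_const, nsmul_eq_mul, Set.ncard_eq_toFinset_card T hT]
    calc F (A * n) + m n ≤ F (A * n) + ∑' h, T.indicator (fun _ => q n) h := by
          rw [hsum]
          have := mul_le_mul_of_nonneg_right hcard (hq n).le
          show _ + (n:ℝ)^D * q n ≤ _
          linarith
      _ = ∑' h, ({h | A * n < wordLen S h}.indicator φ h + T.indicator (fun _ => q n) h) :=
          ((hφs _).tsum_add hsT).symm
      _ ≤ F n := by
          refine ((hφs _).add hsT).tsum_le_tsum (fun h => ?_) (hφs _)
          by_cases h1 : A * n < wordLen S h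
          · have h2 : n < wordLen S h := by nlinarith
            have h3 : h ∉ T := fun hh => by
              have : wordLen S h ≤ A * n := hh.1
              omega
            rw [Set.indicator_of_mem (show h ∈ {h | A * n < wordLen S h} from h1),
              Set.indicator_of_mem (show h ∈ {h | n < wordLen S h} from h2),
              Set.indicator_of_notMem h3, add_zero]
          · rw [Set.indicator_of_notMem (show h ∉ {h | A * n < wordLen S h} from h1), zero_add]
            by_cases h2 : n < wordLen S h
            · rw [Set.indicator_of_mem (show h ∈ T from ⟨not_lt.mp h1, not_le.mpr h2⟩),
                Set.indicator_of_mem (show h ∈ {h | n < wordLen S h} from h2)]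
              refine le_trans ?_ (hφbound h)
              have hw : (wordLen S h : ℝ) ≤ (A:ℝ) * n := by exact_mod_cast not_lt.mp h1
              have hp := hlpos (1 + (wordLen S h : ℝ) ^ 2) (by positivity)
              have : l (1 + (wordLen S h : ℝ) ^ 2) ≤ l (1 + ((A:ℝ) * n) ^ 2) :=
                hlmono (show (0:ℝ) ≤ _ by positivity) (show (0:ℝ) ≤ _ by positivity) (by gcongr)
              show c / _ ≤ _
              gcongr
            · rw [Set.indicator_of_notMem (show h ∉ T from fun hh => hh.2 (not_lt.mp h2)),
                Set.indicator_of_notMem (show h ∉ {h | n < wordLen S h} from h2)]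
  let K : ℝ := (A:ℝ)^2 * (2 * A)^D * K1 / c
  have hK : 0 < K := by positivity
  have hm : ∀ n : ℕ, 1 ≤ n → (A:ℝ) ^ 2 / l ((n:ℝ) ^ 2) ≤ K * m n := by
    intro n hn
    have hn' : (1:ℝ) ≤ n := by exact_mod_cast hn
    have hln := hlpos ((n:ℝ)^2) (by positivity)
    have hl1 := hlpos (1 + ((A:ℝ) * n) ^ 2) (by positivity)
    have h1 : l (1 + ((A:ℝ) * n) ^ 2) ≤ K1 * l ((n:ℝ)^2) := by
      refine le_trans ?_ (hdb ((n:ℝ)^2) (by nlinarith))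
      refine hlmono (show (0:ℝ) ≤ _ by positivity) (show (0:ℝ) ≤ _ by positivity) ?_
      have : 1 ≤ ((A:ℝ) * n) := by nlinarith
      nlinarith
    have h2 : (1 + (A:ℝ) * n) ^ D ≤ (2 * A) ^ D * (n:ℝ)^D := by
      rw [← mul_pow]
      gcongr
      nlinarith
    have h3 : c / (((2 * A) ^ D * (n:ℝ)^D) * (K1 * l ((n:ℝ)^2))) ≤ q n := by
      show _ ≤ c / _
      gcongr
    calc (A:ℝ) ^ 2 / l ((n:ℝ) ^ 2) 
        = K * ((n:ℝ)^D * (c / (((2 * A) ^ D * (n:ℝ)^D) * (K1 * l ((n:ℝ)^2))))) := by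
          show _ = (A:ℝ)^2 * (2 * A)^D * K1 / c * _
          field_simp
      _ ≤ K * m n := by
          show _ ≤ K * ((n:ℝ)^D * q n)
          gcongr
  refine ⟨K, hK, fun g => ?_⟩
  set r := max (wordLen S g) 1 with hr
  have hr1 : 1 ≤ r := le_max_right _ _
  have hrr : (1:ℝ) ≤ r := by exact_mod_cast hr1
  have h1 := aux_tail l hlpos hlmono hlint A hA2 F m hF hFm K hK hm r hr1
  have h2 : F r ≤ ∑' h, {h | wordLen S g ≤ wordLen S h}.indicator φ h := by
    refine (hφs _).tsum_le_tsum (fun h => ?_) (hφs _)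
    refine Set.indicator_le_indicator_of_subset (fun h (hh : r < _) => ?_) (fun x => hφ.1 x) h
    show wordLen S g ≤ wordLen S h
    omega
  have hr2 : (r:ℝ)^2 ≤ 1 + (wordLen S g : ℝ)^2 := by
    rcases max_choice (wordLen S g) 1 with h | h
    · rw [hr, h]; linarith
    · rw [hr, h]; push_cast; nlinarith [sq_nonneg (wordLen S g : ℝ)]
  refine le_trans ?_ (h1.trans (mul_le_mul_of_nonneg_left h2 hK.le))
  refine setIntegral_mono_set (hlint.mono_set (Set.Ioc_subset_Ioc_right ?_))
    (aux_I_nonneg l hlpos _) (Set.Ioc_subset_Ioc_right ?_).eventuallyLE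
  · rw [div_le_one (by positivity)]; nlinarith
  · exact one_div_le_one_div_of_le (by positivity) hr2

/-- pseudo-Poincaré inequality on a group of polynomial volume growth:
`Σ_x |f(xg)-f(x)|² ≤ C θ(1+|g|²) E_φ(f,f)`. -/
theorem statement13 (l : ℝ → ℝ) (hlcont : ContinuousOn l (Set.Ici 0))
    (hlpos : ∀ x, 0 ≤ x → 0 < l x) (hlmono : MonotoneOn l (Set.Ici 0))
    (hlsv : SlowlyVarying l)
    (hlint : IntegrableOn (fun t => 1 / (t * l (1 / t))) (Set.Ioc 0 1))
    {G : Type*} [Group G] (S : Set G) (hS : IsSymmGen S) (D : ℕ) (hD : PolyGrowth S D)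
    (φ : G → ℝ) (hφ : IsSymmProb φ)
    (c C : ℝ) (hc : 0 < c) (hC : 0 < C)
    (hφbound : ∀ g : G,
      c / ((1 + (wordLen S g : ℝ)) ^ D * l (1 + (wordLen S g : ℝ) ^ 2)) ≤ φ g ∧
      φ g ≤ C / ((1 + (wordLen S g : ℝ)) ^ D * l (1 + (wordLen S g : ℝ) ^ 2))) :
    ∃ C' : ℝ, 0 < C' ∧ ∀ (g : G) (f : G → ℝ), MemL2 f →
      (∑' x : G, |f (x * g) - f x| ^ 2) ≤
        C' * thetaOf l (1 + (wordLen S g : ℝ) ^ 2) * dirichlet φ f := by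
  obtain ⟨K, hK, hlow⟩ := aux_lower l hlpos hlmono hlsv hlint S D hD φ hφ c hc
    (fun g => (hφbound g).1)
  obtain ⟨K1, hK1, hdb⟩ := aux_dbl l hlpos hlmono hlsv 4 (by norm_num)
  let K2 : ℝ := C * 2 ^ D * K1 / c
  have hK2 : 0 < K2 := by positivity
  have hcomp : ∀ g h : G, wordLen S g ≤ wordLen S h → φ h ≤ K2 * φ (g⁻¹ * h) := by
    intro g h hgh
    have hlen : wordLen S (g⁻¹ * h) ≤ 2 * wordLen S h := by
      have := aux_len S hS g h
      omega
    have hlen' : (wordLen S (g⁻¹ * h) : ℝ) ≤ 2 * wordLen S h := by exact_mod_cast hlen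
    have hp := hlpos (1 + (wordLen S h : ℝ) ^ 2) (by positivity)
    have hp' := hlpos (1 + (wordLen S (g⁻¹ * h) : ℝ) ^ 2) (by positivity)
    have h1 : l (1 + (wordLen S (g⁻¹ * h) : ℝ) ^ 2) ≤ K1 * l (1 + (wordLen S h : ℝ) ^ 2) := by
      refine le_trans ?_ (hdb (1 + (wordLen S h : ℝ) ^ 2) (by nlinarith [sq_nonneg (wordLen S h : ℝ)]))
      refine hlmono (show (0:ℝ) ≤ _ by positivity) (show (0:ℝ) ≤ _ by positivity) ?_
      have : (wordLen S (g⁻¹ * h) : ℝ)^2 ≤ (2 * wordLen S h)^2 := by gcongr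
      nlinarith
    have h2 : (1 + (wordLen S (g⁻¹ * h) : ℝ)) ^ D ≤ 2 ^ D * (1 + (wordLen S h : ℝ)) ^ D := by
      rw [← mul_pow]
      gcongr
      linarith
    have h3 : c / ((2 ^ D * (1 + (wordLen S h : ℝ)) ^ D) * (K1 * l (1 + (wordLen S h : ℝ) ^ 2)))
        ≤ φ (g⁻¹ * h) := by
      refine le_trans ?_ (hφbound (g⁻¹ * h)).1
      gcongr
    calc φ h ≤ C / ((1 + (wordLen S h : ℝ)) ^ D * l (1 + (wordLen S h : ℝ) ^ 2)) := (hφbound h).2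
      _ = K2 * (c / ((2 ^ D * (1 + (wordLen S h : ℝ)) ^ D) * (K1 * l (1 + (wordLen S h : ℝ) ^ 2)))) := by
        show _ = C * 2 ^ D * K1 / c * _
        field_simp
      _ ≤ _ := by gcongr
  refine ⟨K * (4 + 4 * K2), by positivity, fun g f hf => ?_⟩
  obtain ⟨hs, hdir⟩ := aux_dir φ hφ f hf
  let u : G → ℝ := fun y => ∑' x : G, |f (x * y) - f x| ^ 2
  have hu : ∀ y, 0 ≤ u y := fun y => tsum_nonneg fun x => by positivity
  let T : Set G := {h | wordLen S g ≤ wordLen S h}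
  let W : ℝ := ∑' y, φ y * u y
  have hs' : Summable (fun y => φ (g⁻¹ * y) * u (g⁻¹ * y)) := 
    (Equiv.mulLeft g⁻¹).summable_iff.mpr hs
  have hsW : ∑' y, φ (g⁻¹ * y) * u (g⁻¹ * y) = W := 
    (Equiv.mulLeft g⁻¹).tsum_eq (fun y => φ y * u y)
  have hmain : (∑' h, T.indicator φ h) * u g ≤ (2 + 2 * K2) * W := by
    have e : (2 + 2 * K2) * W = 
        ∑' y, (2 * (φ y * u y) + 2 * K2 * (φ (g⁻¹ * y) * u (g⁻¹ * y))) := by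
      rw [Summable.tsum_add (hs.mul_left 2) (hs'.mul_left (2 * K2)), tsum_mul_left, tsum_mul_left, hsW]
      show _ = 2 * W + _
      ring
    rw [e, ← tsum_mul_right]
    refine Summable.tsum_le_tsum (fun h => ?_) ((hφ.2.1.indicator T).mul_right _)
      ((hs.mul_left 2).add (hs'.mul_left (2 * K2)))
    have h1 := mul_nonneg (hφ.1 h) (hu h)
    have h2 := mul_nonneg (hφ.1 (g⁻¹ * h)) (hu (g⁻¹ * h))
    by_cases hT : h ∈ T
    · rw [Set.indicator_of_mem hT]
      have h3 : u g ≤ 2 * u h + 2 * u (g⁻¹ * h) := aux_tri f hf g h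
      have h4 := mul_le_mul_of_nonneg_left h3 (hφ.1 h)
      have h5 := mul_le_mul_of_nonneg_right (hcomp g h hT) (hu (g⁻¹ * h))
      nlinarith
    · rw [Set.indicator_of_notMem hT, zero_mul]
      positivity
  have hI := hlow g
  have hIpos : 0 < ∫ t in Set.Ioc (0:ℝ) (1 / (1 + (wordLen S g : ℝ) ^ 2)), 1 / (t * l (1 / t)) := by
    have ha : 0 < 1 / (1 + (wordLen S g : ℝ) ^ 2) := by positivity
    rw [setIntegral_pos_iff_support_of_nonneg_ae (aux_I_nonneg l hlpos _)]
    · rw [Set.inter_eq_self_of_subset_right, Real.volume_Ioc]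
      · simpa using ha
      · intro t ht
        have h0 := ht.1
        have := hlpos (1/t) (by positivity)
        exact (show 0 < 1 / (t * l (1 / t)) by positivity).ne'
    · refine hlint.mono_set (Set.Ioc_subset_Ioc_right ?_)
      rw [div_le_one (by positivity)]
      nlinarith [sq_nonneg (wordLen S g : ℝ)]
  unfold thetaOf
  rw [hdir]
  set I := ∫ t in Set.Ioc (0:ℝ) (1 / (1 + (wordLen S g : ℝ) ^ 2)), 1 / (t * l (1 / t))
  show u g ≤ K * (4 + 4 * K2) * (1 / I) * (1 / 2 * W)
  have e : K * (4 + 4 * K2) * (1 / I) * (1 / 2 * W) = (K * ((2 + 2 * K2) * W)) / I := by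
    field_simp
    ring
  rw [e, le_div_iff₀ hIpos]
  have h1 := mul_le_mul_of_nonneg_right hI (hu g)
  have h2 := mul_le_mul_of_nonneg_left hmain hK.le
  change I * u g ≤ K * (∑' h, T.indicator φ h) * u g at h1
  linarith
end
end
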